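/- In any embedding of a 2-connected planar graph in the sphere S^2, the boundary of every face is a cycle of the graph. -/

import Mathlib

open SimpleGraph

noncomputable section

/-- The 2-sphere. -/
abbrev Sphere2 : Type := Metric.sphere (0 : EuclideanSpace ℝ (Fin 3)) 1

/-- An embedding of a simple graph `G` in the 2-sphere: an injective placement of the
vertices, together with, for each edge, an injective arc joining the images of its
endpoints, such that arcs meet vertices only at their endpoints and two arcs of distinct
edges meet only in common endpoints. -/
structure SphereEmbedding {V : Type*} (G : SimpleGraph V) where
  vmap : V → Sphere2
  vmap_inj : Function.Injective vmap
  arc : ∀ {u v : V}, G.Adj u v → Path (vmap u) (vmap v)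
  arc_inj : ∀ {u v : V} (h : G.Adj u v), Function.Injective (arc h)
  arc_symm : ∀ {u v : V} (h : G.Adj u v), Set.range (arc h.symm) = Set.range (arc h)
  arc_vertex : ∀ {u v : V} (h : G.Adj u v) (w : V),
    vmap w ∈ Set.range (arc h) → w = u ∨ w = v
  arc_disjoint : ∀ {u v u' v' : V} (h : G.Adj u v) (h' : G.Adj u' v'),
    s(u, v) ≠ s(u', v') →
      Set.range (arc h) ∩ Set.range (arc h') ⊆
        ({vmap u, vmap v} : Set Sphere2) ∩ ({vmap u', vmap v'} : Set Sphere2)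

/-- The point set of the embedded graph. -/
def SphereEmbedding.image {V : Type*} {G : SimpleGraph V} (E : SphereEmbedding G) :
    Set Sphere2 :=
  Set.range E.vmap ∪ ⋃ (u : V) (v : V) (h : G.Adj u v), Set.range (E.arc h)

/-- A face (region) of the embedding: a connected component of the complement of the
embedded graph. -/
def SphereEmbedding.IsFace {V : Type*} {G : SimpleGraph V} (E : SphereEmbedding G)
    (F : Set Sphere2) : Prop :=
  ∃ p ∈ E.imageᶜ, F = connectedComponentIn E.imageᶜ p

/-- The point set of an embedded walk. -/
def SphereEmbedding.walkImage {V : Type*} {G : SimpleGraph V} (E : SphereEmbedding G) :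
    ∀ {a b : V}, G.Walk a b → Set Sphere2
  | a, _, SimpleGraph.Walk.nil => {E.vmap a}
  | _, _, SimpleGraph.Walk.cons h p => Set.range (E.arc h) ∪ E.walkImage p

/-! ### Plane topology -/

lemma circle_no_log {R : ℝ} (hR : 0 < R) (g : ℂ → ℂ)
    (hg : ContinuousOn g (Metric.sphere 0 R))
    (hexp : ∀ z ∈ Metric.sphere (0 : ℂ) R, Complex.exp (g z) = z) : False := by
  have hc : Continuous fun t : ℝ => g (circleMap 0 R t) :=
    hg.comp_continuous (continuous_circleMap 0 R) (fun t => circleMap_mem_sphere 0 hR.le t)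
  have key : ∀ t : ℝ, ∃ n : ℤ,
      g (circleMap 0 R t) - Real.log R - t * Complex.I = n * (2 * Real.pi * Complex.I) := by
    intro t
    have h1 := hexp _ (circleMap_mem_sphere 0 hR.le t)
    have h2 : Complex.exp (Real.log R + t * Complex.I) = circleMap 0 R t := by
      rw [Complex.exp_add, ← Complex.ofReal_exp, Real.exp_log hR]
      simp [circleMap]
    obtain ⟨n, hn⟩ := Complex.exp_eq_exp_iff_exists_int.1 (h1.trans h2.symm)
    exact ⟨n, by rw [hn]; ring⟩
  set φ : ℝ → ℝ := fun t =>
    ((g (circleMap 0 R t) - Real.log R - t * Complex.I).im) / (2 * Real.pi) with hφ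
  have hφc : Continuous φ := by
    apply Continuous.div_const
    apply Complex.continuous_im.comp
    exact (hc.sub continuous_const).sub (by fun_prop)
  have hφz : ∀ t, ∃ n : ℤ, φ t = n := by
    intro t
    obtain ⟨n, hn⟩ := key t
    refine ⟨n, ?_⟩
    rw [hφ]
    simp only [hn]
    have := Real.pi_pos
    simp
  choose N hN using hφz
  have hNc : Continuous N := by
    have : Continuous (fun t => (N t : ℝ)) := by
      have : (fun t => (N t : ℝ)) = φ := by ext t; rw [hN]
      rw [this]; exact hφc
    exact Int.isClosedEmbedding_coe_real.isInducing.continuous_iff.2 this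
  have hconst : N 0 = N (2 * Real.pi) := by
    apply PreconnectedSpace.constant inferInstance hNc
  have e0 : φ 0 = φ (2 * Real.pi) := by rw [hN, hN, hconst]
  have hp := Real.pi_pos
  have hper : circleMap 0 R (2 * Real.pi) = circleMap 0 R 0 := by
    simp [circleMap]
  rw [hφ] at e0
  simp only [hper] at e0
  rw [div_left_inj' (by positivity)] at e0
  simp at e0
  linarith

lemma exists_log_of_simplyConnected {A : Type*} [TopologicalSpace A] [SimplyConnectedSpace A]
    [LocallyPathConnectedSpace A] (h : A → ℂ) (hc : Continuous h) (h0 : ∀ z, h z ≠ 0) :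
    ∃ g : A → ℂ, Continuous g ∧ ∀ z, Complex.exp (g z) = h z := by
  have a0 : A := Classical.arbitrary A
  obtain ⟨F, ⟨-, hF⟩, -⟩ := Complex.isCoveringMapOn_exp.existsUnique_continuousMap_lifts
    (⟨h, hc⟩ : C(A, ℂ)) (a₀ := a0) (Complex.exp_log (h0 a0)) (fun a => h0 a)
  exact ⟨F, F.continuous, fun z => congrFun hF z⟩

lemma plane_no_log {U : Set ℂ} (_ : IsOpen U) (hb : Bornology.IsBounded U) (h0 : (0 : ℂ) ∈ U)
    (g : ℂ → ℂ) (hg : ContinuousOn g (frontier U))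
    (hexp : ∀ z ∈ frontier U, Complex.exp (g z) = z) : False := by
  classical
  obtain ⟨G, hG⟩ := ContinuousMap.exists_restrict_eq (s := frontier U) isClosed_frontier
    ⟨(frontier U).domRestrict g, hg.domRestrict⟩
  have hG' : ∀ z ∈ frontier U, G z = g z := fun z hz => by
    have := congrArg (fun f : C(frontier U, ℂ) => f ⟨z, hz⟩) hG
    simpa using! this
  let h : ℂ → ℂ := fun z => if z ∈ U then Complex.exp (G z) else z
  have hc : Continuous h := by
    apply Continuous.if
    · intro a ha
      rw [hG' a ha, hexp a ha]
    · exact Complex.continuous_exp.comp G.continuous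
    · exact continuous_id
  have hne : ∀ z, h z ≠ 0 := by
    intro z
    by_cases hz : z ∈ U
    · simp [h, hz]
    · simp only [h, hz, if_false]
      rintro rfl
      exact hz h0
  obtain ⟨l, hl, hle⟩ := exists_log_of_simplyConnected h hc hne
  obtain ⟨R, hR⟩ := hb.subset_ball (0 : ℂ)
  have hRpos : 0 < R := by simpa using hR h0
  refine circle_no_log hRpos l hl.continuousOn fun z hz => ?_
  rw [hle]
  have : z ∉ U := fun hzU => by
    have := hR hzU
    simp at this hz
    linarith
  simp [h, this]

/-- `x - z` has a continuous logarithm on `K`. -/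
def HasLog (K : Set ℂ) (z : ℂ) : Prop :=
  ∃ g : ℂ → ℂ, ContinuousOn g K ∧ ∀ x ∈ K, Complex.exp (g x) = x - z

lemma one_sub_mem_slitPlane {w : ℂ} (h : ‖w‖ < 1) : 1 - w ∈ Complex.slitPlane := by
  left
  have := Complex.re_le_norm w
  simp
  linarith

lemma HasLog.near {K : Set ℂ} {z z' : ℂ} (h : HasLog K z') (hz : ∀ x ∈ K, ‖z - z'‖ < ‖x - z'‖) :
    HasLog K z := by
  obtain ⟨g, hg, he⟩ := h
  have hne : ∀ x ∈ K, x - z' ≠ 0 := fun x hx h0 => by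
    have := hz x hx
    rw [h0, norm_zero] at this
    exact absurd this (not_lt.2 (norm_nonneg _))
  have hs : ∀ x ∈ K, 1 - (z - z') / (x - z') ∈ Complex.slitPlane := fun x hx => by
    apply one_sub_mem_slitPlane
    rw [norm_div, div_lt_one (norm_pos_iff.2 (hne x hx))]
    exact hz x hx
  refine ⟨fun x => g x + Complex.log (1 - (z - z') / (x - z')), ?_, ?_⟩
  · apply hg.add
    apply ContinuousOn.clog _ hs
    apply continuousOn_const.sub
    apply continuousOn_const.div (by fun_prop) hne
  · intro x hx
    rw [Complex.exp_add, he x hx, Complex.exp_log (Complex.slitPlane_ne_zero (hs x hx))]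
    have := hne x hx
    field_simp
    ring

lemma HasLog.far {K : Set ℂ} {z : ℂ} (hz : ∀ x ∈ K, ‖x‖ < ‖z‖) : HasLog K z := by
  by_cases hz0 : z = 0
  · subst hz0
    refine ⟨0, continuousOn_const, fun x hx => ?_⟩
    have := hz x hx
    simp at this
    exact absurd this (not_lt.2 (norm_nonneg x))
  have hs : ∀ x ∈ K, 1 - x / z ∈ Complex.slitPlane := fun x hx => by
    apply one_sub_mem_slitPlane
    rw [norm_div, div_lt_one (norm_pos_iff.2 hz0)]
    exact hz x hx
  refine ⟨fun x => Complex.log (-z) + Complex.log (1 - x / z), ?_, ?_⟩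
  · apply continuousOn_const.add
    apply ContinuousOn.clog _ hs
    fun_prop
  · intro x hx
    rw [Complex.exp_add, Complex.exp_log (neg_ne_zero.2 hz0),
      Complex.exp_log (Complex.slitPlane_ne_zero (hs x hx))]
    field_simp
    ring

lemma hasLog_locally_const {K : Set ℂ} (hK : IsClosed K) {z₀ : ℂ} (hz : z₀ ∉ K) :
    ∃ r > 0, ∀ z ∈ Metric.ball z₀ r, z ∉ K ∧ (HasLog K z ↔ HasLog K z₀) := by
  obtain ⟨r, hr, hrK⟩ := Metric.isOpen_iff.1 hK.isOpen_compl z₀ hz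
  have far : ∀ x ∈ K, r ≤ ‖x - z₀‖ := fun x hx => by
    by_contra! h
    exact hrK (by simpa [dist_eq_norm] using h) hx
  refine ⟨r / 2, by positivity, fun z hz' => ?_⟩
  rw [Metric.mem_ball, dist_eq_norm] at hz'
  refine ⟨fun h => by linarith [far z h], fun h => h.near fun x hx => ?_, fun h => h.near
    fun x hx => ?_⟩
  · have h1 := far x hx
    have h2 : ‖x - z₀‖ ≤ ‖x - z‖ + ‖z - z₀‖ := norm_sub_le_norm_sub_add_norm_sub x z z₀
    rw [norm_sub_rev]
    linarith
  · linarith [far x hx]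

/-! ### Sphere -/

instance : Fact (Module.finrank ℝ (EuclideanSpace ℝ (Fin 3)) = 2 + 1) := ⟨by simp⟩

instance : LocallyPathConnectedSpace Sphere2 :=
  ChartedSpace.locallyPathConnectedSpace (EuclideanSpace ℝ (Fin 2)) Sphere2

lemma exists_chart (p q : Sphere2) (_ : p ≠ q) :
    ∃ s : OpenPartialHomeomorph Sphere2 ℂ, s.source = {q}ᶜ ∧ s.target = Set.univ ∧ s p = 0 := by
  let e : EuclideanSpace ℝ (Fin 2) ≃ₜ ℂ := Complex.orthonormalBasisOneI.repr.symm.toHomeomorph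
  let s := (stereographic' 2 q).trans e.toOpenPartialHomeomorph
  let t := s.trans (Homeomorph.addRight (-(s p))).toOpenPartialHomeomorph
  refine ⟨t, ?_, ?_, ?_⟩
  · simp [t, s]
  · simp [t, s]
  · simp [t]

/-- `T` does not separate `p` and `q`. -/
def NS (T : Set Sphere2) (p q : Sphere2) : Prop :=
  ∃ S : Set Sphere2, IsPreconnected S ∧ S ⊆ Tᶜ ∧ p ∈ S ∧ q ∈ S

lemma NS.mono {T T' : Set Sphere2} {p q : Sphere2} (h : NS T p q) (hT : T' ⊆ T) : NS T' p q := by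
  obtain ⟨S, h1, h2, h3⟩ := h
  exact ⟨S, h1, h2.trans (Set.compl_subset_compl.2 hT), h3⟩

lemma NS.left {T : Set Sphere2} {p q : Sphere2} (h : NS T p q) : p ∉ T := by
  obtain ⟨S, h1, h2, h3, h4⟩ := h
  exact h2 h3

lemma NS.right {T : Set Sphere2} {p q : Sphere2} (h : NS T p q) : q ∉ T := by
  obtain ⟨S, h1, h2, h3, h4⟩ := h
  exact h2 h4

lemma NS.refl {T : Set Sphere2} {p : Sphere2} (h : p ∉ T) : NS T p p :=
  ⟨{p}, isPreconnected_singleton, by simpa using h, rfl, rfl⟩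

lemma NS.symm {T : Set Sphere2} {p q : Sphere2} (h : NS T p q) : NS T q p := by
  obtain ⟨S, h1, h2, h3, h4⟩ := h
  exact ⟨S, h1, h2, h4, h3⟩

lemma NS.trans {T : Set Sphere2} {p q r : Sphere2} (h : NS T p q) (h' : NS T q r) : NS T p r := by
  obtain ⟨S, h1, h2, h3, h4⟩ := h
  obtain ⟨S', h1', h2', h3', h4'⟩ := h'
  exact ⟨S ∪ S', h1.union q h4 h3' h1', Set.union_subset h2 h2', Or.inl h3, Or.inr h4'⟩

lemma ns_iff {T : Set Sphere2} {p q : Sphere2} (hp : p ∉ T) :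
    NS T p q ↔ q ∈ connectedComponentIn Tᶜ p := by
  constructor
  · rintro ⟨S, h1, h2, h3, h4⟩
    exact h1.subset_connectedComponentIn h3 h2 h4
  · intro h
    exact ⟨_, isPreconnected_connectedComponentIn, connectedComponentIn_subset _ _,
      mem_connectedComponentIn hp, h⟩

lemma log_of_ns {T : Set Sphere2} (hT : IsClosed T) {p q : Sphere2} (h : NS T p q)
    (s : OpenPartialHomeomorph Sphere2 ℂ) (hs : s.source = {q}ᶜ) (ht : s.target = Set.univ)
    (hsp : s p = 0) (hpq : p ≠ q) :
    ∃ g : Sphere2 → ℂ, ContinuousOn g T ∧ ∀ x ∈ T, Complex.exp (g x) = s x := by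
  have hTs : T ⊆ s.source := by
    rw [hs]; rintro x hx rfl; exact h.right hx
  set K := s '' T with hKdef
  have hK : IsCompact K := hT.isCompact.image_of_continuousOn (s.continuousOn.mono hTs)
  have hinj : ∀ x ≠ q, s x ∈ K → x ∈ T := by
    rintro x hx ⟨y, hy, hxy⟩
    have := s.injOn (hTs hy) (by rw [hs]; exact hx) hxy
    rwa [← this]
  by_cases hL : HasLog K 0
  · obtain ⟨g, hg, he⟩ := hL
    refine ⟨g ∘ s, hg.comp (s.continuousOn.mono hTs) (fun x hx => ⟨x, hx, rfl⟩), fun x hx => ?_⟩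
    simpa using he (s x) ⟨x, hx, rfl⟩
  exfalso
  let W : Set ℂ := {z | z ∉ K ∧ ¬ HasLog K z}
  let W' : Set ℂ := {z | z ∉ K ∧ HasLog K z}
  have hW : IsOpen W := by
    rw [Metric.isOpen_iff]
    rintro z ⟨hz, hz'⟩
    obtain ⟨r, hr, hr'⟩ := hasLog_locally_const hK.isClosed hz
    exact ⟨r, hr, fun y hy => ⟨(hr' y hy).1, fun h => hz' ((hr' y hy).2.1 h)⟩⟩
  have hW' : IsOpen W' := by
    rw [Metric.isOpen_iff]
    rintro z ⟨hz, hz'⟩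
    obtain ⟨r, hr, hr'⟩ := hasLog_locally_const hK.isClosed hz
    exact ⟨r, hr, fun y hy => ⟨(hr' y hy).1, (hr' y hy).2.2 hz'⟩⟩
  obtain ⟨R, hR⟩ := hK.isBounded.subset_ball (0 : ℂ)
  have hcont : Continuous s.symm := by
    have := s.symm.continuousOn
    rw [s.symm_source, ht] at this
    exact continuousOn_univ.1 this
  let B : Set Sphere2 := (s.symm '' Metric.closedBall 0 R)ᶜ
  have hB : IsOpen B :=
    ((isCompact_closedBall (0 : ℂ) R).image hcont).isClosed.isOpen_compl
  have hqB : q ∈ B := by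
    rintro ⟨z, -, hz⟩
    have : s.symm z ∈ s.source := s.map_target (by rw [ht]; trivial)
    rw [hs, hz] at this
    exact this rfl
  have hO1 : IsOpen (s.source ∩ s ⁻¹' W) := s.isOpen_inter_preimage hW
  have hO2 : IsOpen ((s.source ∩ s ⁻¹' W') ∪ B) := (s.isOpen_inter_preimage hW').union hB
  have hBW : ∀ x ∈ B, x ≠ q → HasLog K (s x) := by
    intro x hx hxq
    apply HasLog.far
    intro y hy
    have h1 := hR hy
    by_contra! h2
    apply hx
    refine ⟨s x, ?_, s.left_inv (by rw [hs]; exact hxq)⟩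
    simp at h1 ⊢
    linarith
  obtain ⟨S, hS, hST, hpS, hqS⟩ := h
  obtain ⟨x, hxS, ⟨hx1, hx2⟩, hx3⟩ := hS _ _ hO1 hO2 (by
      intro x hx
      by_cases hxq : x = q
      · right; right; rw [hxq]; exact hqB
      · have h1 : x ∈ s.source := by rw [hs]; exact hxq
        have h2 : s x ∉ K := fun h => hST hx (hinj x hxq h)
        by_cases h3 : HasLog K (s x)
        · right; left; exact ⟨h1, h2, h3⟩
        · left; exact ⟨h1, h2, h3⟩)
    ⟨p, hpS, by rw [hs]; exact hpq, fun h => hST hpS (hinj p hpq h), by rw [hsp]; exact hL⟩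
    ⟨q, hqS, Or.inr hqB⟩
  rcases hx3 with hx3 | hx3
  · exact hx2.2 hx3.2.2
  · rw [hs] at hx1
    exact hx2.2 (hBW x hx3 hx1)

lemma frontier_component {T : Set Sphere2} (hT : IsClosed T) (p : Sphere2) :
    frontier (connectedComponentIn Tᶜ p) ⊆ T := by
  intro x hx
  by_contra hxT
  have hO : IsOpen (connectedComponentIn Tᶜ p) := hT.isOpen_compl.connectedComponentIn
  have hO' : IsOpen (connectedComponentIn Tᶜ x) := hT.isOpen_compl.connectedComponentIn
  rw [hO.frontier_eq] at hx
  obtain ⟨y, hy, hy'⟩ := mem_closure_iff.1 hx.1 _ hO' (mem_connectedComponentIn hxT)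
  apply hx.2
  rw [connectedComponentIn_eq hy', ← connectedComponentIn_eq hy]
  exact mem_connectedComponentIn hxT

lemma ns_of_log {T : Set Sphere2} (hT : IsClosed T) {p q : Sphere2} (hp : p ∉ T) (hq : q ∉ T)
    (s : OpenPartialHomeomorph Sphere2 ℂ) (hs : s.source = {q}ᶜ) (ht : s.target = Set.univ)
    (hsp : s p = 0) (hpq : p ≠ q)
    (g : Sphere2 → ℂ) (hg : ContinuousOn g T) (he : ∀ x ∈ T, Complex.exp (g x) = s x) :
    NS T p q := by
  rw [ns_iff hp]
  by_contra hqU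
  set U := connectedComponentIn Tᶜ p with hUdef
  have hO : IsOpen U := hT.isOpen_compl.connectedComponentIn
  have hfr : frontier U ⊆ T := frontier_component hT p
  have hqcl : q ∉ closure U := by
    intro h
    have : q ∈ frontier U := by rw [hO.frontier_eq]; exact ⟨h, hqU⟩
    exact hq (hfr this)
  have hemb : Topology.IsOpenEmbedding s.symm :=
    s.symm.isOpenEmbedding (by simpa using ht)
  have hsymm : ∀ z, s (s.symm z) = z := fun z => s.right_inv (by rw [ht]; trivial)
  have hfr' : frontier (s.symm ⁻¹' U) = s.symm ⁻¹' frontier U :=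
    (hemb.isOpenMap.preimage_frontier_eq_frontier_preimage hemb.continuous U).symm
  refine plane_no_log (U := s.symm ⁻¹' U) (hO.preimage hemb.continuous) ?_ ?_ (g ∘ s.symm) ?_ ?_
  · have hcl : closure U ⊆ s.source := by
      rw [hs]; rintro x hx rfl; exact hqcl hx
    refine ((isClosed_closure (s := U)).isCompact.image_of_continuousOn
      (s.continuousOn.mono hcl)).isBounded.subset ?_
    intro z hz
    exact ⟨s.symm z, subset_closure hz, hsymm z⟩
  · show s.symm 0 ∈ U
    rw [← hsp, s.left_inv (by rw [hs]; exact hpq)]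
    exact mem_connectedComponentIn hp
  · rw [hfr']
    exact hg.comp hemb.continuous.continuousOn fun z hz => hfr hz
  · rw [hfr']
    intro z hz
    simp only [Function.comp]
    rw [he _ (hfr hz), hsymm]

/-- Theorem of Janiszewski. -/
lemma janiszewski {A B : Set Sphere2} (hA : IsClosed A) (hB : IsClosed B)
    (hAB : IsPreconnected (A ∩ B)) {p q : Sphere2} (h1 : NS A p q) (h2 : NS B p q) :
    NS (A ∪ B) p q := by
  classical
  have hp : p ∉ A ∪ B := fun h => h.elim h1.left h2.left
  have hq : q ∉ A ∪ B := fun h => h.elim h1.right h2.right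
  by_cases hpq : p = q
  · subst hpq; exact NS.refl hp
  obtain ⟨s, hs, ht, hsp⟩ := exists_chart p q hpq
  obtain ⟨g, hg, hge⟩ := log_of_ns hA h1 s hs ht hsp hpq
  obtain ⟨k, hk, hke⟩ := log_of_ns hB h2 s hs ht hsp hpq
  obtain ⟨c, hc, hcc⟩ : ∃ c : ℂ, Complex.exp c = 1 ∧ ∀ x ∈ A ∩ B, g x = k x + c := by
    have key : ∀ x ∈ A ∩ B, ∃ n : ℤ, g x = k x + n * (2 * Real.pi * Complex.I) := fun x hx =>
      Complex.exp_eq_exp_iff_exists_int.1 ((hge x hx.1).trans (hke x hx.2).symm)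
    rcases (A ∩ B).eq_empty_or_nonempty with he | ⟨y, hy⟩
    · exact ⟨0, by simp, by simp [he]⟩
    · obtain ⟨n, hn⟩ := key y hy
      refine ⟨n * (2 * Real.pi * Complex.I), Complex.exp_int_mul_two_pi_mul_I n, fun x hx => ?_⟩
      choose! N hN using key
      have hcN : ContinuousOn N (A ∩ B) := by
        have h3 : ContinuousOn (fun x => ((g x - k x).im / (2 * Real.pi))) (A ∩ B) := by
          apply ContinuousOn.div_const
          apply Complex.continuous_im.comp_continuousOn
          exact (hg.mono Set.inter_subset_left).sub (hk.mono Set.inter_subset_right)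
        have h4 : ContinuousOn (fun x => (N x : ℝ)) (A ∩ B) := by
          refine h3.congr fun x hx => ?_
          simp only
          rw [hN x hx]
          have := Real.pi_pos
          simp
        exact Int.isClosedEmbedding_coe_real.isInducing.continuousOn_iff.2 h4
      have h5 : N x = N y := hAB.constant hcN hx hy
      have h6 := hN y hy
      rw [hN x hx, h5, ← add_left_cancel (h6.symm.trans hn)]
  refine ns_of_log (hA.union hB) hp hq s hs ht hsp hpq
    (fun x => if x ∈ A then g x else k x + c) ?_ ?_
  · have e1 : ContinuousOn (fun x => if x ∈ A then g x else k x + c) A :=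
      hg.congr fun x hx => by simp [hx]
    have e2 : ContinuousOn (fun x => if x ∈ A then g x else k x + c) B := by
      refine (hk.add (continuousOn_const (c := c))).congr fun x hx => ?_
      by_cases hxA : x ∈ A
      · simp [hxA, hcc x ⟨hxA, hx⟩]
      · simp [hxA]
    exact e1.union_of_isClosed e2 hA hB
  · intro x hx
    by_cases hxA : x ∈ A
    · simp [hxA, hge x hxA]
    · simp only [hxA, if_false]
      rw [Complex.exp_add, hc, mul_one, hke x (hx.resolve_left hxA)]

/-- An arc does not separate the sphere. -/
lemma arc_ns (c : unitInterval → Sphere2) (hc : Continuous c) (hi : Function.Injective c)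
    {p q : Sphere2} (hp : p ∉ Set.range c) (hq : q ∉ Set.range c) : NS (Set.range c) p q := by
  by_cases hpq : p = q
  · subst hpq; exact NS.refl hp
  obtain ⟨s, hs, ht, hsp⟩ := exists_chart p q hpq
  have hemb : Topology.IsClosedEmbedding c := hc.isClosedEmbedding hi
  have hsrc : ∀ t, c t ∈ s.source := fun t => by
    rw [hs]; intro h; exact hq ⟨t, h⟩
  obtain ⟨l', hl', hle'⟩ := exists_log_of_simplyConnected
    (fun t : ℝ => s (c (Set.projIcc 0 1 zero_le_one t)))
    ((s.continuousOn.comp_continuous hc hsrc).comp continuous_projIcc) (fun t h0 => hp ⟨_, by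
      apply s.injOn (hsrc _) (by rw [hs]; exact hpq)
      rw [h0, hsp]⟩)
  obtain ⟨l, hl, hle⟩ : ∃ l : unitInterval → ℂ, Continuous l ∧
      ∀ t, Complex.exp (l t) = s (c t) :=
    ⟨fun t => l' t, hl'.comp continuous_subtype_val, fun t => by
      rw [hle', Set.projIcc_val]⟩
  obtain ⟨g, hg⟩ := ContinuousMap.exists_extension' hemb (⟨l, hl⟩ : C(unitInterval, ℂ))
  refine ns_of_log hemb.isClosed_range hp hq s hs ht hsp hpq g g.continuous.continuousOn ?_
  rintro _ ⟨t, rfl⟩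
  have : g (c t) = l t := congrFun hg t
  rw [this, hle]


lemma not_ns_of_frontier {U T : Set Sphere2} (hf : frontier U ⊆ T) {p q : Sphere2}
    (hp : p ∈ U) (hq : q ∉ U) : ¬ NS T p q := by
  rintro ⟨S, hS, hST, hpS, hqS⟩
  have hintr : ∀ x ∈ S, x ∈ U → x ∈ interior U := fun x hx hxU => by
    by_contra h
    exact hST hx (hf ⟨subset_closure hxU, h⟩)
  have hcl : ∀ x ∈ S, x ∉ U → x ∈ (closure U)ᶜ := fun x hx hxU h =>
    hST hx (hf ⟨h, fun h' => hxU (interior_subset h')⟩)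
  obtain ⟨x, -, hx1, hx2⟩ := hS _ _ isOpen_interior (isClosed_closure (s := U)).isOpen_compl
    (fun x hx => by
      by_cases hxU : x ∈ U
      · exact Or.inl (hintr x hx hxU)
      · exact Or.inr (hcl x hx hxU))
    ⟨p, hpS, hintr p hpS hp⟩ ⟨q, hqS, hcl q hqS hq⟩
  exact hx2 (subset_closure (interior_subset hx1))

lemma exists_compact_connected {Ω Q : Set Sphere2} (hΩ : IsOpen Ω) (hc : IsPreconnected Ω)
    (hQ : IsCompact Q) (hQΩ : Q ⊆ Ω) :
    ∃ L, IsCompact L ∧ IsPreconnected L ∧ Q ⊆ L ∧ L ⊆ Ω := by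
  rcases Ω.eq_empty_or_nonempty with he | ⟨x₀, hx₀⟩
  · exact ⟨Q, hQ, by
      have : Q = ∅ := Set.subset_empty_iff.1 (he ▸ hQΩ)
      rw [this]; exact isPreconnected_empty, subset_rfl, hQΩ⟩
  have hpc : IsPathConnected Ω := hΩ.isConnected_iff_isPathConnected.1 ⟨⟨x₀, hx₀⟩, hc⟩
  suffices h : ∃ L, IsCompact L ∧ IsPreconnected L ∧ Q ⊆ L ∧ L ⊆ Ω ∧ x₀ ∈ L by
    obtain ⟨L, h1, h2, h3, h4, -⟩ := h
    exact ⟨L, h1, h2, h3, h4⟩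
  refine hQ.induction_on
    (p := fun Q => ∃ L, IsCompact L ∧ IsPreconnected L ∧ Q ⊆ L ∧ L ⊆ Ω ∧ x₀ ∈ L) ?_ ?_ ?_ ?_
  · exact ⟨{x₀}, isCompact_singleton, isPreconnected_singleton, by simp, by simpa, rfl⟩
  · rintro s t hst ⟨L, h1, h2, h3, h4⟩
    exact ⟨L, h1, h2, hst.trans h3, h4⟩
  · rintro s t ⟨L, h1, h2, h3, h4, h5⟩ ⟨L', h1', h2', h3', h4', h5'⟩
    exact ⟨L ∪ L', h1.union h1', h2.union x₀ h5 h5' h2', Set.union_subset_union h3 h3',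
      Set.union_subset h4 h4', Or.inl h5⟩
  · intro x hx
    obtain ⟨N, hN, hNcl, hNΩ⟩ := exists_mem_nhds_isClosed_subset (hΩ.mem_nhds (hQΩ hx))
    obtain ⟨V, ⟨hV, hVc⟩, hVN⟩ := (LocallyPathConnectedSpace.path_connected_basis x).mem_iff.1 hN
    obtain ⟨γ, hγ⟩ := hpc.joinedIn x₀ hx₀ x (hQΩ hx)
    have hcl : closure V ⊆ N := closure_minimal hVN hNcl
    refine ⟨V, mem_nhdsWithin_of_mem_nhds hV, Set.range γ ∪ closure V, ?_, ?_, ?_, ?_, ?_⟩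
    · exact (isCompact_range γ.continuous).union isClosed_closure.isCompact
    · exact (isPreconnected_range γ.continuous).union x ⟨1, γ.target⟩
        (subset_closure (mem_of_mem_nhds hV)) hVc.isConnected.isPreconnected.closure
    · exact subset_closure.trans Set.subset_union_right
    · refine Set.union_subset ?_ (hcl.trans hNΩ)
      rintro _ ⟨t, rfl⟩
      exact hγ t
    · exact Or.inl ⟨0, γ.source⟩

/-- Jordan separation. -/
lemma jordan_sep {A B : Set Sphere2} (hA : IsClosed A) (hB : IsClosed B) (hAc : IsPreconnected A)
    (hBc : IsPreconnected B) {v w : Sphere2} (hvw : v ≠ w) (hvA : v ∈ A) (hwA : w ∈ A)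
    (hvB : v ∈ B) (hwB : w ∈ B) (hAB : A ∩ B ⊆ {v, w}) : ¬ IsPreconnected (A ∪ B)ᶜ := by
  intro hc
  obtain ⟨s, hs, ht, hsv⟩ := exists_chart v w hvw
  have hcont : Continuous s.symm := by
    have := s.symm.continuousOn
    rw [s.symm_source, ht] at this
    exact continuousOn_univ.1 this
  have hsymm : ∀ z, s (s.symm z) = z := fun z => s.right_inv (by rw [ht]; trivial)
  let S := s.symm '' Metric.sphere 0 1
  have hS : IsCompact S := (isCompact_sphere (0 : ℂ) 1).image hcont
  have hvS : v ∉ S := by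
    rintro ⟨z, hz, hzv⟩
    have := hsymm z
    rw [hzv, hsv] at this
    subst this
    simp at hz
  have hwS : w ∉ S := by
    rintro ⟨z, hz, hzv⟩
    have : s.symm z ∈ s.source := s.map_target (by rw [ht]; trivial)
    rw [hs, hzv] at this
    exact this rfl
  have hSAB : ∀ x ∈ S, ¬ (x ∈ A ∧ x ∈ B) := by
    intro x hx hxAB
    rcases hAB hxAB with h | h
    · exact hvS (h ▸ hx)
    · exact hwS (h ▸ hx)
  let SA := S ∩ {x | Metric.infDist x B ≤ Metric.infDist x A}
  let SB := S ∩ {x | Metric.infDist x A ≤ Metric.infDist x B}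
  have hSA : IsCompact SA := hS.inter_right
    (isClosed_le (Metric.continuous_infDist_pt B) (Metric.continuous_infDist_pt A))
  have hSB : IsCompact SB := hS.inter_right
    (isClosed_le (Metric.continuous_infDist_pt A) (Metric.continuous_infDist_pt B))
  have hSA' : ∀ x ∈ SA, x ∉ A := by
    rintro x ⟨hx, hx'⟩ hxA
    refine hSAB x hx ⟨hxA, ?_⟩
    rw [hB.mem_iff_infDist_zero ⟨v, hvB⟩]
    have h0 := (hA.mem_iff_infDist_zero ⟨v, hvA⟩).1 hxA
    simp only [Set.mem_ofPred_eq, h0] at hx'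
    exact le_antisymm hx' Metric.infDist_nonneg
  have hSB' : ∀ x ∈ SB, x ∉ B := by
    rintro x ⟨hx, hx'⟩ hxB
    refine hSAB x hx ⟨?_, hxB⟩
    rw [hA.mem_iff_infDist_zero ⟨v, hvA⟩]
    have h0 := (hB.mem_iff_infDist_zero ⟨v, hvB⟩).1 hxB
    simp only [Set.mem_ofPred_eq, h0] at hx'
    exact le_antisymm hx' Metric.infDist_nonneg
  obtain ⟨L, hLc, hLp, hL1, hL2⟩ := exists_compact_connected (hA.union hB).isOpen_compl hc
    (hSA.inter hSB) (by
      rintro x ⟨h1, h2⟩ (h | h)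
      · exact hSA' x h1 h
      · exact hSB' x h2 h)
  have n1 : NS (SA ∪ L) v w := ⟨A, hAc, fun x hx h => h.elim (fun h => hSA' x h hx)
    (fun h => hL2 h (Or.inl hx)), hvA, hwA⟩
  have n2 : NS (SB ∪ L) v w := ⟨B, hBc, fun x hx h => h.elim (fun h => hSB' x h hx)
    (fun h => hL2 h (Or.inr hx)), hvB, hwB⟩
  have n3 := janiszewski (hSA.union hLc).isClosed (hSB.union hLc).isClosed (by
    rw [← Set.inter_union_distrib_right, Set.union_eq_self_of_subset_left hL1]
    exact hLp) n1 n2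
  have n4 : NS S v w := n3.mono (by
    intro x hx
    rcases le_total (Metric.infDist x B) (Metric.infDist x A) with h | h
    · exact Or.inl (Or.inl ⟨hx, h⟩)
    · exact Or.inr (Or.inl ⟨hx, h⟩))
  obtain ⟨g, hg, he⟩ := log_of_ns hS.isClosed n4 s hs ht hsv hvw
  refine circle_no_log one_pos (g ∘ s.symm) (hg.comp hcont.continuousOn fun z hz => ⟨z, hz, rfl⟩)
    fun z hz => ?_
  simp only [Function.comp]
  rw [he _ ⟨z, hz, rfl⟩, hsymm]

lemma no_inj_plane_line (φ : ℂ → ℝ) (hc : Continuous φ) (hi : Function.Injective φ) : False := by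
  have mid : ∀ a b c : ℂ, φ a < φ b → φ b < φ c → False := by
    intro a b c h1 h2
    have hconn : IsPreconnected ({b}ᶜ : Set ℂ) :=
      (isConnected_compl_singleton_of_one_lt_rank (by
        rw [Complex.rank_real_complex]; exact Cardinal.one_lt_two) b).isPreconnected
    obtain ⟨x, hx, hxb⟩ := hconn.intermediate_value (a := a) (b := c)
      (by rintro rfl; exact lt_irrefl _ h1) (by rintro rfl; exact lt_irrefl _ h2)
      hc.continuousOn ⟨h1.le, h2.le⟩
    exact hx (hi hxb)
  have h01 : φ 0 ≠ φ 1 := hi.ne (by norm_num)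
  have h02 : φ 0 ≠ φ 2 := hi.ne (by norm_num)
  have h12 : φ 1 ≠ φ 2 := hi.ne (by norm_num)
  have m1 := mid 0 1 2
  have m2 := mid 0 2 1
  have m3 := mid 1 0 2
  have m4 := mid 1 2 0
  have m5 := mid 2 0 1
  have m6 := mid 2 1 0
  rcases lt_or_gt_of_ne h01 with a | a <;> rcases lt_or_gt_of_ne h02 with b | b <;>
    rcases lt_or_gt_of_ne h12 with c | c <;> tauto

lemma arc_interior_empty (c : unitInterval → Sphere2) (hc : Continuous c)
    (hi : Function.Injective c) : interior (Set.range c) = ∅ := by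
  by_contra hne
  obtain ⟨x, hx⟩ := Set.nonempty_iff_ne_empty.2 hne
  have hxn : x ≠ -x := by
    intro h
    have h1 : (x : EuclideanSpace ℝ (Fin 3)) = -x := congrArg Subtype.val h
    have h2 : (x : EuclideanSpace ℝ (Fin 3)) = 0 := by
      have h3 : (2 : ℝ) • (x : EuclideanSpace ℝ (Fin 3)) = 0 := by
        rw [two_smul]
        nth_rewrite 2 [h1]
        simp
      simpa using h3
    have := norm_eq_of_mem_sphere x
    rw [h2] at this
    simp at this
  obtain ⟨s, hs, ht, hsx⟩ := exists_chart x (-x) hxn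
  have hcont : Continuous s.symm := by
    have := s.symm.continuousOn
    rw [s.symm_source, ht] at this
    exact continuousOn_univ.1 this
  have hsymm : ∀ z, s (s.symm z) = z := fun z => s.right_inv (by rw [ht]; trivial)
  have hO : IsOpen (s.symm ⁻¹' interior (Set.range c)) := isOpen_interior.preimage hcont
  obtain ⟨r, hr, hball⟩ := Metric.isOpen_iff.1 hO 0 (by
    rw [Set.mem_preimage, ← hsx, s.left_inv (by rw [hs]; exact hxn)]
    exact hx)
  let b := OpenPartialHomeomorph.univBall (0 : ℂ) r
  have hbc : Continuous b := OpenPartialHomeomorph.continuous_univBall 0 r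
  have hbi : Function.Injective b := by
    have := b.injOn
    rw [OpenPartialHomeomorph.univBall_source] at this
    exact Set.injOn_univ.1 this
  have hbm : ∀ z, b z ∈ Metric.ball (0 : ℂ) r := fun z => by
    have := b.map_source (x := z) (by rw [OpenPartialHomeomorph.univBall_source]; trivial)
    rwa [OpenPartialHomeomorph.univBall_target _ hr] at this
  have hemb : Topology.IsEmbedding c := (hc.isClosedEmbedding hi).isEmbedding
  let e := hemb.toHomeomorph
  let d : ℂ → Set.range c := fun z => ⟨s.symm (b z), interior_subset (hball (hbm z))⟩
  have hd : Continuous d := (hcont.comp hbc).subtype_mk _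
  have hdi : Function.Injective d := by
    intro z z' h
    have h1 : s.symm (b z) = s.symm (b z') := congrArg Subtype.val h
    have h2 := congrArg s h1
    rw [hsymm, hsymm] at h2
    exact hbi h2
  exact no_inj_plane_line (fun z => (e.symm (d z) : ℝ))
    (continuous_subtype_val.comp (e.symm.continuous.comp hd))
    (Subtype.val_injective.comp (e.symm.injective.comp hdi))

lemma singleton_ns {a p q : Sphere2} (hp : p ≠ a) (hq : q ≠ a) : NS {a} p q := by
  obtain ⟨s, hs, ht, -⟩ := exists_chart p a hp
  have hcont : Continuous s.symm := by
    have := s.symm.continuousOn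
    rw [s.symm_source, ht] at this
    exact continuousOn_univ.1 this
  refine ⟨Set.range s.symm, isPreconnected_range hcont, ?_,
    ⟨s p, s.left_inv (by rw [hs]; exact hp)⟩, ⟨s q, s.left_inv (by rw [hs]; exact hq)⟩⟩
  rintro _ ⟨z, rfl⟩
  have : s.symm z ∈ s.source := s.map_target (by rw [ht]; trivial)
  rwa [hs] at this

lemma jordan_free (p q : Sphere2) : NS ∅ p q := by
  by_cases h : p = q
  · subst h; exact NS.refl (by simp)
  · have hpq : ∃ a : Sphere2, p ≠ a ∧ q ≠ a := by
      by_contra! hall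
      have hsub : (Set.univ : Set Sphere2) ⊆ {p, q} := fun a _ => by
        by_cases h1 : p = a
        · exact Or.inl h1.symm
        · exact Or.inr (hall a h1).symm
      obtain ⟨s, hs, ht, -⟩ := exists_chart p q h
      have h0 : s.symm 0 ∈ s.source := s.map_target (by rw [ht]; trivial)
      have h1 : s.symm 1 ∈ s.source := s.map_target (by rw [ht]; trivial)
      rw [hs] at h0 h1
      have e0 : s.symm 0 = p := (hsub (Set.mem_univ (s.symm 0))).resolve_right h0
      have e1 : s.symm 1 = p := (hsub (Set.mem_univ (s.symm 1))).resolve_right h1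
      have r0 := s.right_inv (x := 0) (by rw [ht]; trivial)
      have r1 := s.right_inv (x := 1) (by rw [ht]; trivial)
      rw [e0] at r0
      rw [e1, r0] at r1
      exact zero_ne_one r1
    obtain ⟨a, h1, h2⟩ := hpq
    exact (singleton_ns h1 h2).mono (by simp)

lemma finite_ns {T : Set Sphere2} (hT : T.Finite) {p q : Sphere2} (hp : p ∉ T) (hq : q ∉ T) :
    NS T p q := by
  induction T, hT using Set.Finite.induction_on with
  | empty =>
    have hpre := jordan_free p q
    exact hpre
  | @insert a S haS hS ih =>
    rw [Set.insert_eq]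
    refine janiszewski isClosed_singleton hS.isClosed ?_ (singleton_ns ?_ ?_)
      (ih (fun h => hp (Or.inr h)) (fun h => hq (Or.inr h)))
    · have : ({a} ∩ S : Set Sphere2) = ∅ := by
        simpa using haS
      rw [this]; exact isPreconnected_empty
    · rintro rfl; exact hp (Or.inl rfl)
    · rintro rfl; exact hq (Or.inl rfl)

lemma subarc_ns (c : unitInterval → Sphere2) (hc : Continuous c) (hi : Function.Injective c)
    {a b : unitInterval} (hab : a ≤ b)
    {p q : Sphere2} (hp : p ∉ c '' Set.Icc a b) (hq : q ∉ c '' Set.Icc a b) :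
    NS (c '' Set.Icc a b) p q := by
  rcases hab.eq_or_lt with rfl | hlt
  · rw [Set.Icc_self, Set.image_singleton] at *
    exact singleton_ns hp hq
  have hlt' : (a : ℝ) < b := hlt
  have ha := a.2
  have hb := b.2
  let f : unitInterval → unitInterval := fun t => ⟨a + t * (b - a), by
    have h1 := t.2.1
    have h2 := t.2.2
    constructor
    · have := mul_nonneg h1 (sub_nonneg.2 hlt'.le)
      linarith [ha.1]
    · have := mul_le_mul_of_nonneg_right h2 (sub_nonneg.2 hlt'.le)
      linarith [hb.2]⟩
  have hf : Continuous f := by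
    apply Continuous.subtype_mk
    fun_prop
  have hfi : Function.Injective f := by
    intro t t' h
    have h1 : (a : ℝ) + t * (b - a) = a + t' * (b - a) := congrArg Subtype.val h
    have h2 : (b : ℝ) - a ≠ 0 := by linarith
    exact Subtype.ext (mul_right_cancel₀ h2 (add_left_cancel h1))
  have hr : Set.range (c ∘ f) = c '' Set.Icc a b := by
    rw [Set.range_comp]
    congr 1
    ext y
    constructor
    · rintro ⟨t, rfl⟩
      have h1 := t.2.1
      have h2 := t.2.2
      constructor
      · show (a : ℝ) ≤ a + t * (b - a)
        have := mul_nonneg h1 (sub_nonneg.2 hlt'.le)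
        linarith
      · show (a : ℝ) + t * (b - a) ≤ b
        have := mul_le_mul_of_nonneg_right h2 (sub_nonneg.2 hlt'.le)
        linarith
    · rintro ⟨h1, h2⟩
      have h1' : (a : ℝ) ≤ y := h1
      have h2' : (y : ℝ) ≤ b := h2
      have h3 : (0 : ℝ) < b - a := by linarith
      refine ⟨⟨((y : ℝ) - a) / (b - a), div_nonneg (by linarith) h3.le,
        (div_le_one h3).2 (by linarith)⟩, ?_⟩
      apply Subtype.ext
      show (a : ℝ) + ((y : ℝ) - a) / (b - a) * (b - a) = y
      rw [div_mul_cancel₀ _ h3.ne']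
      ring
  rw [← hr] at hp hq ⊢
  exact arc_ns _ (hc.comp hf) (hi.comp hfi) hp hq

lemma comp_absorb {T S : Set Sphere2} {p : Sphere2} (hS : IsPreconnected S) (hST : S ⊆ Tᶜ)
    (hm : (S ∩ connectedComponentIn Tᶜ p).Nonempty) : S ⊆ connectedComponentIn Tᶜ p := by
  obtain ⟨y, hy, hy'⟩ := hm
  rw [connectedComponentIn_eq hy']
  exact hS.subset_connectedComponentIn hy hST

namespace SphereEmbedding

variable {V : Type*} {G : SimpleGraph V} (E : SphereEmbedding G)

/-- The relative interior of an edge. -/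
def edgeInt {u v : V} (h : G.Adj u v) : Set Sphere2 :=
  Set.range (E.arc h) \ {E.vmap u, E.vmap v}

lemma left_mem {u v : V} (h : G.Adj u v) : E.vmap u ∈ Set.range (E.arc h) := ⟨0, (E.arc h).source⟩
lemma right_mem {u v : V} (h : G.Adj u v) : E.vmap v ∈ Set.range (E.arc h) := ⟨1, (E.arc h).target⟩

lemma arc_closed {u v : V} (h : G.Adj u v) : IsClosed (Set.range (E.arc h)) :=
  (isCompact_range (E.arc h).continuous).isClosed

lemma arc_conn {u v : V} (h : G.Adj u v) : IsPreconnected (Set.range (E.arc h)) :=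
  isPreconnected_range (E.arc h).continuous

lemma arc_congr {u v u' v' : V} (h : G.Adj u v) (h' : G.Adj u' v') (e : s(u, v) = s(u', v')) :
    Set.range (E.arc h) = Set.range (E.arc h') := by
  rcases Sym2.eq_iff.1 e with ⟨rfl, rfl⟩ | ⟨rfl, rfl⟩
  · rfl
  · exact (E.arc_symm h).symm

lemma edgeInt_congr {u v u' v' : V} (h : G.Adj u v) (h' : G.Adj u' v')
    (e : s(u, v) = s(u', v')) : E.edgeInt h = E.edgeInt h' := by
  rcases Sym2.eq_iff.1 e with ⟨rfl, rfl⟩ | ⟨rfl, rfl⟩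
  · rfl
  · rw [edgeInt, edgeInt, E.arc_congr h h' e, Set.pair_comm]

lemma edgeInt_ne {u v : V} (h : G.Adj u v) {z : Sphere2} (hz : z ∈ E.edgeInt h) (w : V) :
    z ≠ E.vmap w := by
  rintro rfl
  rcases E.arc_vertex h w hz.1 with rfl | rfl
  · exact hz.2 (Or.inl rfl)
  · exact hz.2 (Or.inr rfl)

lemma edgeInt_arc {u v u' v' : V} (h : G.Adj u v) (h' : G.Adj u' v') {z : Sphere2}
    (hz : z ∈ E.edgeInt h) (hz' : z ∈ Set.range (E.arc h')) : s(u, v) = s(u', v') := by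
  by_contra hne
  exact hz.2 (E.arc_disjoint h h' hne ⟨hz.1, hz'⟩).1

lemma arc_cases {u v : V} (h : G.Adj u v) {z : Sphere2} (hz : z ∈ Set.range (E.arc h)) :
    z = E.vmap u ∨ z = E.vmap v ∨ z ∈ E.edgeInt h := by
  by_cases h1 : z = E.vmap u
  · exact Or.inl h1
  by_cases h2 : z = E.vmap v
  · exact Or.inr (Or.inl h2)
  exact Or.inr (Or.inr ⟨hz, by simp [h1, h2]⟩)

lemma edgeInt_eq {u v : V} (h : G.Adj u v) :
    E.edgeInt h = E.arc h '' Set.Ioo 0 1 := by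
  ext z
  constructor
  · rintro ⟨⟨t, rfl⟩, hz⟩
    refine ⟨t, ⟨?_, ?_⟩, rfl⟩
    · apply lt_of_le_of_ne t.2.1
      intro h0
      apply hz
      left
      have : t = 0 := Subtype.ext h0.symm
      rw [this, (E.arc h).source]
    · apply lt_of_le_of_ne t.2.2
      intro h0
      apply hz
      right
      have : t = 1 := Subtype.ext h0
      rw [this, (E.arc h).target]; rfl
  · rintro ⟨t, ⟨h0, h1⟩, rfl⟩
    refine ⟨⟨t, rfl⟩, ?_⟩
    rintro (h2 | h2)
    · exact h0.ne' (E.arc_inj h (Eq.trans h2 (E.arc h).source.symm))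
    · exact h1.ne (E.arc_inj h (Eq.trans h2 (E.arc h).target.symm))

lemma edgeInt_conn {u v : V} (h : G.Adj u v) : IsPreconnected (E.edgeInt h) := by
  rw [edgeInt_eq]
  exact isPreconnected_Ioo.image _ (E.arc h).continuous.continuousOn

lemma arc_subset_closure {u v : V} (h : G.Adj u v) :
    Set.range (E.arc h) ⊆ closure (E.edgeInt h) := by
  rw [edgeInt_eq]
  have h1 : closure (Set.Ioo (0 : unitInterval) 1) = Set.univ := by
    rw [closure_Ioo (by simp)]
    exact Set.eq_univ_of_forall fun t => ⟨t.2.1, t.2.2⟩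
  rw [← Set.image_univ, ← h1]
  exact image_closure_subset_closure_image (E.arc h).continuous

lemma walkImage_closed {a b : V} (p : G.Walk a b) : IsClosed (E.walkImage p) := by
  induction p with
  | nil => exact isClosed_singleton
  | cons h p ih => exact (E.arc_closed h).union ih

lemma vmap_mem_walkImage {a b : V} (p : G.Walk a b) {c : V} (hc : c ∈ p.support) :
    E.vmap c ∈ E.walkImage p := by
  induction p with
  | nil => simp at hc; subst hc; exact rfl
  | cons h p ih =>
    rw [Walk.support_cons, List.mem_cons] at hc
    rcases hc with rfl | hc
    · exact Or.inl (E.left_mem h)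
    · exact Or.inr (ih hc)

lemma walkImage_conn {a b : V} (p : G.Walk a b) : IsPreconnected (E.walkImage p) := by
  induction p with
  | nil => exact isPreconnected_singleton
  | cons h p ih =>
    exact (E.arc_conn h).union _ (E.right_mem h) (E.vmap_mem_walkImage p p.start_mem_support) ih

lemma arc_subset_walkImage {a b : V} (p : G.Walk a b) {u v : V} (h : G.Adj u v)
    (he : s(u, v) ∈ p.edges) : Set.range (E.arc h) ⊆ E.walkImage p := by
  induction p with
  | nil => simp at he
  | cons h' p ih =>
    rw [Walk.edges_cons, List.mem_cons] at he
    rcases he with he | he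
    · rw [E.arc_congr h h' he]; exact Set.subset_union_left
    · exact (ih he).trans Set.subset_union_right

lemma mem_walkImage {a b : V} (p : G.Walk a b) {z : Sphere2} (hz : z ∈ E.walkImage p) :
    (∃ c ∈ p.support, z = E.vmap c) ∨
      ∃ (u v : V) (h : G.Adj u v), s(u, v) ∈ p.edges ∧ z ∈ E.edgeInt h := by
  induction p with
  | nil => exact Or.inl ⟨_, by simp, hz⟩
  | @cons u v _ h p ih =>
    rcases hz with hz | hz
    · rcases E.arc_cases h hz with hz | hz | hz
      · exact Or.inl ⟨u, by simp, hz⟩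
      · exact Or.inl ⟨v, by simp, hz⟩
      · exact Or.inr ⟨u, v, h, by simp, hz⟩
    · rcases ih hz with ⟨c, hc, hz⟩ | ⟨x, y, h', he, hz⟩
      · exact Or.inl ⟨c, by simp [hc], hz⟩
      · exact Or.inr ⟨x, y, h', by simp [he], hz⟩

lemma mem_support_of_vmap {a b : V} (p : G.Walk a b) {c : V} (h : E.vmap c ∈ E.walkImage p) :
    c ∈ p.support := by
  rcases E.mem_walkImage p h with ⟨d, hd, he⟩ | ⟨u, v, h', -, hz⟩
  · rwa [E.vmap_inj he]
  · exact absurd rfl (E.edgeInt_ne h' hz c)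

lemma mem_edges_of_edgeInt {a b : V} (p : G.Walk a b) {u v : V} (h : G.Adj u v) {z : Sphere2}
    (hz : z ∈ E.edgeInt h) (hp : z ∈ E.walkImage p) : s(u, v) ∈ p.edges := by
  rcases E.mem_walkImage p hp with ⟨d, hd, he⟩ | ⟨u', v', h', he, hz'⟩
  · exact absurd he (E.edgeInt_ne h hz d)
  · rwa [E.edgeInt_arc h h' hz hz'.1]

lemma walkImage_append {a b c : V} (p : G.Walk a b) (q : G.Walk b c) :
    E.walkImage (p.append q) = E.walkImage p ∪ E.walkImage q := by
  induction p with
  | nil =>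
    symm
    apply Set.union_eq_self_of_subset_left
    rintro _ rfl
    exact E.vmap_mem_walkImage q q.start_mem_support
  | cons h p ih =>
    rw [Walk.cons_append]
    show _ ∪ _ = (_ ∪ _) ∪ _
    rw [ih, Set.union_assoc]

lemma arc_subset_image {u v : V} (h : G.Adj u v) : Set.range (E.arc h) ⊆ E.image := by
  intro z hz
  right
  simp only [Set.mem_iUnion]
  exact ⟨u, v, h, hz⟩

lemma walkImage_subset_image {a b : V} (p : G.Walk a b) : E.walkImage p ⊆ E.image := by
  induction p with
  | nil => rintro _ rfl; exact Or.inl ⟨_, rfl⟩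
  | cons h p ih => exact Set.union_subset (E.arc_subset_image h) ih

lemma image_closed [Finite V] : IsClosed E.image := by
  refine (Set.finite_range _).isClosed.union ?_
  refine isClosed_iUnion_of_finite fun u => isClosed_iUnion_of_finite fun v =>
    isClosed_iUnion_of_finite fun h => E.arc_closed h

lemma path_ns {a b : V} (p : G.Walk a b) (hp : p.IsPath) {x y : Sphere2}
    (hx : x ∉ E.walkImage p) (hy : y ∉ E.walkImage p) : NS (E.walkImage p) x y := by
  induction p with
  | nil => exact singleton_ns hx hy
  | @cons u v _ h p ih =>
    rw [Walk.cons_isPath_iff] at hp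
    refine janiszewski (E.arc_closed h) (E.walkImage_closed p) ?_
      (arc_ns _ (E.arc h).continuous (E.arc_inj h) (fun h => hx (Or.inl h))
        (fun h => hy (Or.inl h)))
      (ih hp.1 (fun h => hx (Or.inr h)) (fun h => hy (Or.inr h)))
    have : Set.range (E.arc h) ∩ E.walkImage p = {E.vmap v} := by
      apply Set.Subset.antisymm
      · rintro z ⟨h1, h2⟩
        rcases E.arc_cases h h1 with rfl | rfl | h3
        · exact absurd (E.mem_support_of_vmap p h2) hp.2
        · rfl
        · exact absurd (p.fst_mem_support_of_mem_edges (E.mem_edges_of_edgeInt p h h3 h2)) hp.2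
      · rintro _ rfl
        exact ⟨E.right_mem h, E.vmap_mem_walkImage p p.start_mem_support⟩
    rw [this]
    exact isPreconnected_singleton

/-- Part of the embedded graph spanned by vertices satisfying `P` and edges in `L` starting
at such vertices. -/
def part (P : V → Prop) (L : Set (Sym2 V)) : Set Sphere2 :=
  (⋃ (c : V) (_ : P c), {E.vmap c}) ∪
    ⋃ (u : V) (v : V) (h : G.Adj u v) (_ : s(u, v) ∈ L ∧ P u), Set.range (E.arc h)

lemma part_closed [Finite V] (P : V → Prop) (L : Set (Sym2 V)) : IsClosed (E.part P L) := by
  refine (isClosed_iUnion_of_finite fun c => isClosed_iUnion_of_finite fun _ =>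
    isClosed_singleton).union ?_
  exact isClosed_iUnion_of_finite fun u => isClosed_iUnion_of_finite fun v =>
    isClosed_iUnion_of_finite fun h => isClosed_iUnion_of_finite fun _ => E.arc_closed h

lemma mem_part {P : V → Prop} {L : Set (Sym2 V)} {z : Sphere2} :
    z ∈ E.part P L ↔ (∃ c, P c ∧ z = E.vmap c) ∨
      ∃ (u v : V) (h : G.Adj u v), (s(u, v) ∈ L ∧ P u) ∧ z ∈ Set.range (E.arc h) := by
  simp only [part, Set.mem_union, Set.mem_iUnion, Set.mem_singleton_iff, exists_prop]

lemma mem_part' {P : V → Prop} {L : Set (Sym2 V)} {z : Sphere2} (hz : z ∈ E.part P L)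
    (hP : ∀ u v, G.Adj u v → s(u, v) ∈ L → P u → P v) :
    (∃ c, P c ∧ z = E.vmap c) ∨
      ∃ (u v : V) (h : G.Adj u v), s(u, v) ∈ L ∧ P u ∧ P v ∧ z ∈ E.edgeInt h := by
  rcases E.mem_part.1 hz with h | ⟨u, v, h, ⟨hL, hu⟩, hz⟩
  · exact Or.inl h
  · rcases E.arc_cases h hz with hz | hz | hz
    · exact Or.inl ⟨u, hu, hz⟩
    · exact Or.inl ⟨v, hP u v h hL hu, hz⟩
    · exact Or.inr ⟨u, v, h, hL, hu, hP u v h hL hu, hz⟩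

/-- If a set of edges separates two points, then some cycle in it does. -/
lemma sep_cycle [Finite V] [DecidableEq V] (L : Finset (Sym2 V)) {p q : Sphere2}
    (hp : p ∉ E.part (fun _ => True) L) (hq : q ∉ E.part (fun _ => True) L)
    (hsep : ¬ NS (E.part (fun _ => True) L) p q) :
    ∃ (a : V) (w : G.Walk a a), w.IsCycle ∧ (∀ e ∈ w.edges, e ∈ L) ∧
      ¬ NS (E.walkImage w) p q := by
  induction L using Finset.induction_on with
  | empty =>
    exfalso
    have : E.part (fun _ => True) ((∅ : Finset (Sym2 V)) : Set (Sym2 V)) = Set.range E.vmap := by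
      ext z
      rw [mem_part]
      simp [eq_comm]
    rw [this] at hp hq hsep
    exact hsep (finite_ns (Set.finite_range _) hp hq)
  | @insert e L heL ih =>
    have hmono : E.part (fun _ => True) (L : Set (Sym2 V)) ⊆
        E.part (fun _ => True) ((insert e L : Finset _) : Set (Sym2 V)) := by
      intro z hz
      rw [mem_part] at *
      refine hz.imp id ?_
      rintro ⟨u, v, h, ⟨h1, h2⟩, h3⟩
      exact ⟨u, v, h, ⟨by simp [Finset.mem_coe.1 h1], h2⟩, h3⟩
    by_cases hns : NS (E.part (fun _ => True) (L : Set (Sym2 V))) p q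
    swap
    · obtain ⟨a, w, h1, h2, h3⟩ := ih (fun h => hp (hmono h)) (fun h => hq (hmono h)) hns
      exact ⟨a, w, h1, fun e he => Finset.mem_insert_of_mem (h2 e he), h3⟩
    induction e using Sym2.ind with
    | _ u v =>
    by_cases h : G.Adj u v
    swap
    · exfalso
      apply hsep
      apply hns.mono
      intro z hz
      rw [mem_part] at *
      refine hz.imp id ?_
      rintro ⟨u', v', h', ⟨h1, h2⟩, h3⟩
      refine ⟨u', v', h', ⟨?_, h2⟩, h3⟩
      simp only [Finset.coe_insert, Set.mem_insert_iff] at h1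
      refine h1.resolve_left fun h4 => h ?_
      rw [← G.mem_edgeSet, ← h4, G.mem_edgeSet]
      exact h'
    have hsub : E.part (fun _ => True) ((insert s(u, v) L : Finset _) : Set (Sym2 V)) ⊆
        E.part (fun _ => True) (L : Set (Sym2 V)) ∪ Set.range (E.arc h) := by
      intro z hz
      rcases E.mem_part.1 hz with hz | ⟨u', v', h', ⟨h1, h2⟩, h3⟩
      · exact Or.inl (E.mem_part.2 (Or.inl hz))
      · simp only [Finset.coe_insert, Set.mem_insert_iff] at h1
        rcases h1 with h1 | h1
        · right
          rwa [← E.arc_congr h' h h1]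
        · exact Or.inl (E.mem_part.2 (Or.inr ⟨u', v', h', ⟨h1, h2⟩, h3⟩))
    have harc : Set.range (E.arc h) ⊆
        E.part (fun _ => True) ((insert s(u, v) L : Finset _) : Set (Sym2 V)) := fun z hz =>
      E.mem_part.2 (Or.inr ⟨u, v, h, ⟨by simp, trivial⟩, hz⟩)
    have hpa : p ∉ Set.range (E.arc h) := fun h => hp (harc h)
    have hqa : q ∉ Set.range (E.arc h) := fun h => hq (harc h)
    have hcl := E.part_closed (fun _ => True) (L : Set (Sym2 V))
    by_cases hw : ∃ P : G.Walk v u, ∀ e ∈ P.edges, e ∈ L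
    · obtain ⟨P₀, hP₀⟩ := hw
      have hP : ∀ e ∈ P₀.bypass.edges, e ∈ L := fun e he =>
        hP₀ e (P₀.edges_bypass_subset_edges he)
      set P := P₀.bypass with hPdef
      have hPp : P.IsPath := P₀.bypass_isPath
      have heP : s(u, v) ∉ P.edges := fun h => heL (hP _ h)
      refine ⟨u, Walk.cons h P, (Walk.cons_isCycle_iff P h).2 ⟨hPp, heP⟩, ?_, ?_⟩
      · intro e he
        rw [Walk.edges_cons, List.mem_cons] at he
        rcases he with rfl | he
        · exact Finset.mem_insert_self _ _
        · exact Finset.mem_insert_of_mem (hP e he)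
      · intro hC
        apply hsep
        refine (janiszewski hcl (E.walkImage_closed (Walk.cons h P)) ?_ hns hC).mono
          (hsub.trans (Set.union_subset_union_right _ Set.subset_union_left))
        have : E.part (fun _ => True) (L : Set (Sym2 V)) ∩ E.walkImage (Walk.cons h P) =
            E.walkImage P := by
          apply Set.Subset.antisymm
          · rintro z ⟨h1, h2 | h2⟩
            · rcases E.arc_cases h h2 with rfl | rfl | h3
              · exact E.vmap_mem_walkImage P P.end_mem_support
              · exact E.vmap_mem_walkImage P P.start_mem_support
              · exfalso
                rcases E.mem_part.1 h1 with ⟨c, -, hc⟩ | ⟨u', v', h', ⟨h4, -⟩, h5⟩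
                · exact E.edgeInt_ne h h3 c hc
                · rw [← E.edgeInt_arc h h' h3 h5] at h4
                  exact heL h4
            · exact h2
          · intro z hz
            refine ⟨?_, Or.inr hz⟩
            rcases E.mem_walkImage P hz with ⟨c, -, hc⟩ | ⟨u', v', h', h4, h5⟩
            · exact E.mem_part.2 (Or.inl ⟨c, trivial, hc⟩)
            · exact E.mem_part.2 (Or.inr ⟨u', v', h', ⟨hP _ h4, trivial⟩, h5.1⟩)
        rw [this]
        exact E.walkImage_conn P
    · exfalso
      apply hsep
      let R : V → Prop := fun c => ∃ P : G.Walk v c, ∀ e ∈ P.edges, e ∈ L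
      have hRu : ¬ R u := hw
      have hRv : R v := ⟨Walk.nil, by simp⟩
      have hR1 : ∀ x y, G.Adj x y → s(x, y) ∈ (L : Set (Sym2 V)) → R x → R y := by
        rintro x y hxy hL ⟨P, hP⟩
        refine ⟨P.concat hxy, fun e he => ?_⟩
        rw [Walk.edges_concat, List.concat_eq_append, List.mem_append, List.mem_singleton] at he
        rcases he with he | rfl
        · exact hP e he
        · exact hL
      have hR2 : ∀ x y, G.Adj x y → s(x, y) ∈ (L : Set (Sym2 V)) → ¬ R x → ¬ R y := by
        intro x y hxy hL hx hy
        rw [Sym2.eq_swap] at hL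
        exact hx (hR1 y x hxy.symm hL hy)
      have hA1 := E.part_closed R (L : Set (Sym2 V))
      have hA2 := E.part_closed (fun c => ¬ R c) (L : Set (Sym2 V))
      have sub1 : ∀ P : V → Prop, E.part P (L : Set (Sym2 V)) ⊆ E.part (fun _ => True) L := by
        intro P z hz
        rw [mem_part] at *
        refine hz.imp ?_ ?_
        · rintro ⟨c, -, hc⟩; exact ⟨c, trivial, hc⟩
        · rintro ⟨x, y, hxy, ⟨h1, -⟩, h2⟩; exact ⟨x, y, hxy, ⟨h1, trivial⟩, h2⟩
      have sub2 : E.part (fun _ => True) (L : Set (Sym2 V)) ⊆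
          E.part (fun c => ¬ R c) L ∪ E.part R L := by
        intro z hz
        rcases E.mem_part.1 hz with ⟨c, -, hc⟩ | ⟨x, y, hxy, ⟨h1, -⟩, h2⟩
        · by_cases hcR : R c
          · exact Or.inr (E.mem_part.2 (Or.inl ⟨c, hcR, hc⟩))
          · exact Or.inl (E.mem_part.2 (Or.inl ⟨c, hcR, hc⟩))
        · by_cases hcR : R x
          · exact Or.inr (E.mem_part.2 (Or.inr ⟨x, y, hxy, ⟨h1, hcR⟩, h2⟩))
          · exact Or.inl (E.mem_part.2 (Or.inr ⟨x, y, hxy, ⟨h1, hcR⟩, h2⟩))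
      have hintr : ∀ z ∈ Set.range (E.arc h), z ∈ E.part (fun _ => True) (L : Set (Sym2 V)) →
          z = E.vmap u ∨ z = E.vmap v := by
        intro z hz h1
        rcases E.arc_cases h hz with h3 | h3 | h3
        · exact Or.inl h3
        · exact Or.inr h3
        · exfalso
          rcases E.mem_part.1 h1 with ⟨c, -, hc⟩ | ⟨u', v', h', ⟨h4, -⟩, h5⟩
          · exact E.edgeInt_ne h h3 c hc
          · rw [← E.edgeInt_arc h h' h3 h5] at h4
            exact heL h4
      have hvert : ∀ (P : V → Prop), (∀ x y, G.Adj x y → s(x, y) ∈ (L : Set (Sym2 V)) →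
          P x → P y) → ∀ c, E.vmap c ∈ E.part P (L : Set (Sym2 V)) → P c := by
        intro P hP c hc
        rcases E.mem_part' hc hP with ⟨d, hd, he⟩ | ⟨x, y, hxy, -, -, -, hz⟩
        · rwa [E.vmap_inj he]
        · exact absurd rfl (E.edgeInt_ne hxy hz c)
      have i1 : E.part R (L : Set (Sym2 V)) ∩ Set.range (E.arc h) = {E.vmap v} := by
        apply Set.Subset.antisymm
        · rintro z ⟨h1, h2⟩
          rcases hintr z h2 (sub1 _ h1) with rfl | rfl
          · exact absurd (hvert R hR1 u h1) hRu
          · rfl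
        · rintro _ rfl
          exact ⟨E.mem_part.2 (Or.inl ⟨v, hRv, rfl⟩), E.right_mem h⟩
      have i2 : E.part (fun c => ¬ R c) (L : Set (Sym2 V)) ∩
          (E.part R (L : Set (Sym2 V)) ∪ Set.range (E.arc h)) = {E.vmap u} := by
        apply Set.Subset.antisymm
        · rintro z ⟨h1, h2 | h2⟩
          · exfalso
            rcases E.mem_part' h1 hR2 with ⟨c, hc, rfl⟩ | ⟨x, y, hxy, hL, hx, hy, hz⟩
            · exact hc (hvert R hR1 c h2)
            · rcases E.mem_part' h2 hR1 with ⟨c, hc, rfl⟩ | ⟨x', y', hxy', hL', hx', hy', hz'⟩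
              · exact hx (absurd rfl (E.edgeInt_ne hxy hz c))
              · rcases Sym2.eq_iff.1 (E.edgeInt_arc hxy hxy' hz hz'.1) with ⟨rfl, rfl⟩ | ⟨rfl, rfl⟩
                · exact hx hx'
                · exact hx hy'
          · rcases hintr z h2 (sub1 _ h1) with rfl | rfl
            · rfl
            · exact absurd hRv (hvert _ hR2 v h1)
        · rintro _ rfl
          exact ⟨E.mem_part.2 (Or.inl ⟨u, hRu, rfl⟩), Or.inr (E.left_mem h)⟩
      have n1 := janiszewski hA1 (E.arc_closed h) (by rw [i1]; exact isPreconnected_singleton)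
        (hns.mono (sub1 _)) (arc_ns _ (E.arc h).continuous (E.arc_inj h) hpa hqa)
      have n2 := janiszewski hA2 (hA1.union (E.arc_closed h))
        (by rw [i2]; exact isPreconnected_singleton) (hns.mono (sub1 _)) n1
      refine n2.mono (hsub.trans ?_)
      rw [← Set.union_assoc]
      exact Set.union_subset_union_left _ sub2

end SphereEmbedding


namespace SphereEmbedding

variable {V : Type*} {G : SimpleGraph V} (E : SphereEmbedding G)

lemma walk_split {a b : V} (p : G.Walk a b) {e : Sym2 V} (he : e ∈ p.edges) :
    ∃ (u v : V) (h : G.Adj u v) (Q₁ : G.Walk a u) (Q₂ : G.Walk v b),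
      e = s(u, v) ∧ p = Q₁.append (Walk.cons h Q₂) := by
  induction p with
  | nil => simp at he
  | cons h p ih =>
    rw [Walk.edges_cons, List.mem_cons] at he
    rcases he with rfl | he
    · exact ⟨_, _, h, Walk.nil, p, rfl, rfl⟩
    · obtain ⟨u, v, h', Q₁, Q₂, h1, h2⟩ := ih he
      exact ⟨u, v, h', Walk.cons h Q₁, Q₂, h1, by rw [h2, Walk.cons_append]⟩

lemma cycle_split {a : V} (w : G.Walk a a) (hw : w.IsCycle) {e : Sym2 V} (he : e ∈ w.edges) :
    ∃ (u v : V) (h : G.Adj u v) (P : G.Walk v u), e = s(u, v) ∧ P.IsPath ∧ s(u, v) ∉ P.edges ∧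
      E.walkImage w = Set.range (E.arc h) ∪ E.walkImage P := by
  obtain ⟨u, v, h, Q₁, Q₂, rfl, rfl⟩ := walk_split w he
  refine ⟨u, v, h, Q₂.append Q₁, rfl, ?_, ?_, ?_⟩
  · have h1 := hw.support_nodup
    rw [Walk.tail_support_append, Walk.support_cons, List.tail_cons] at h1
    rw [Walk.isPath_def, Walk.support_append]
    exact List.nodup_append_comm.1 h1
  · have h1 := hw.edges_nodup
    rw [Walk.edges_append, Walk.edges_cons] at h1
    rw [Walk.edges_append]
    have h2 := List.nodup_middle.1 h1
    rw [List.nodup_cons] at h2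
    intro h3
    apply h2.1
    rw [List.mem_append] at *
    exact h3.symm
  · rw [walkImage_append, walkImage_append]
    show _ ∪ (_ ∪ _) = _
    ac_rfl

lemma bd_aux {u v : V} (h : G.Adj u v) (P : G.Walk v u) (hP : P.IsPath) (he : s(u, v) ∉ P.edges)
    {C : Set Sphere2} (hC : C = Set.range (E.arc h) ∪ E.walkImage P) {r r' : Sphere2}
    (hr : r ∉ C) (hr' : r' ∉ C) (hns : ¬ NS C r r') :
    E.edgeInt h ⊆ closure (connectedComponentIn Cᶜ r) := by
  have hCc : IsClosed C := by rw [hC]; exact (E.arc_closed h).union (E.walkImage_closed P)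
  intro z hz
  by_contra hzU
  set U := connectedComponentIn Cᶜ r with hU
  rw [edgeInt_eq] at hz
  obtain ⟨t, ht, rfl⟩ := hz
  have hnh : (E.arc h) ⁻¹' (closure U)ᶜ ∈ nhds t :=
    (isClosed_closure.isOpen_compl.preimage (E.arc h).continuous).mem_nhds hzU
  obtain ⟨l, k, ⟨hlt, htk⟩, hsub⟩ :=
    (mem_nhds_iff_exists_Ioo_subset' ⟨0, ht.1⟩ ⟨1, ht.2⟩).1 hnh
  have hAl : IsClosed (E.arc h '' Set.Icc 0 l) :=
    (isCompact_Icc.image (E.arc h).continuous).isClosed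
  have hAk : IsClosed (E.arc h '' Set.Icc k 1) :=
    (isCompact_Icc.image (E.arc h).continuous).isClosed
  have hsl : E.arc h '' Set.Icc 0 l ⊆ C := by
    rw [hC]; exact (Set.image_subset_range _ _).trans Set.subset_union_left
  have hsk : E.arc h '' Set.Icc k 1 ⊆ C := by
    rw [hC]; exact (Set.image_subset_range _ _).trans Set.subset_union_left
  have hsP : E.walkImage P ⊆ C := by rw [hC]; exact Set.subset_union_right
  have hinter : ∀ s : unitInterval, E.arc h s ∈ E.walkImage P → s = 0 ∨ s = 1 := by
    intro s hs
    rcases E.arc_cases h ⟨s, rfl⟩ with h1 | h1 | h1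
    · exact Or.inl (E.arc_inj h (h1.trans (E.arc h).source.symm))
    · exact Or.inr (E.arc_inj h (h1.trans (E.arc h).target.symm))
    · exact absurd (E.mem_edges_of_edgeInt P h h1 hs) he
  have i1 : E.arc h '' Set.Icc 0 l ∩ E.walkImage P = {E.vmap u} := by
    apply Set.Subset.antisymm
    · rintro _ ⟨⟨s, hs, rfl⟩, h2⟩
      rcases hinter s h2 with rfl | rfl
      · exact (E.arc h).source
      · exact absurd (hs.2.trans_lt (hlt.trans ht.2)) (lt_irrefl _)
    · rintro _ rfl
      exact ⟨⟨0, ⟨le_rfl, unitInterval.nonneg'⟩, (E.arc h).source⟩,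
        E.vmap_mem_walkImage P P.end_mem_support⟩
  have i2 : (E.arc h '' Set.Icc 0 l ∪ E.walkImage P) ∩ E.arc h '' Set.Icc k 1 = {E.vmap v} := by
    apply Set.Subset.antisymm
    · rintro _ ⟨h2, ⟨s, hs, rfl⟩⟩
      rcases h2 with ⟨s', hs', h3⟩ | h2
      · have := E.arc_inj h h3
        subst this
        exact absurd ((hlt.trans htk).trans_le hs.1) (not_lt.2 hs'.2)
      rcases hinter s h2 with rfl | rfl
      · exact absurd (hs.1.trans_lt (ht.1.trans htk)) (lt_irrefl _)
      · exact (E.arc h).target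
    · rintro _ rfl
      exact ⟨Or.inr (E.vmap_mem_walkImage P P.start_mem_support),
        ⟨1, ⟨unitInterval.le_one', le_rfl⟩, (E.arc h).target⟩⟩
  have n1 := janiszewski hAl (E.walkImage_closed P) (by rw [i1]; exact isPreconnected_singleton)
    (subarc_ns _ (E.arc h).continuous (E.arc_inj h) unitInterval.nonneg'
      (fun h => hr (hsl h)) (fun h => hr' (hsl h)))
    (E.path_ns P hP (fun h => hr (hsP h)) (fun h => hr' (hsP h)))
  have n2 := janiszewski (hAl.union (E.walkImage_closed P)) hAk
    (by rw [i2]; exact isPreconnected_singleton) n1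
    (subarc_ns _ (E.arc h).continuous (E.arc_inj h) unitInterval.le_one'
      (fun h => hr (hsk h)) (fun h => hr' (hsk h)))
  refine not_ns_of_frontier (U := U) ?_ (mem_connectedComponentIn hr)
    (fun h => hns ((ns_iff hr).2 h)) n2
  intro y hy
  have hyC := frontier_component hCc r hy
  rw [hC] at hyC
  rcases hyC with ⟨s, rfl⟩ | hyC
  · by_cases h1 : s ≤ l
    · exact Or.inl (Or.inl ⟨s, ⟨unitInterval.nonneg', h1⟩, rfl⟩)
    by_cases h2 : k ≤ s
    · exact Or.inr ⟨s, ⟨h2, unitInterval.le_one'⟩, rfl⟩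
    exact absurd hy.1 (hsub ⟨not_le.1 h1, not_le.1 h2⟩)
  · exact Or.inl (Or.inr hyC)

/-- If a cycle separates two points then each edge lies in the closure of the corresponding
component. -/
lemma bd_edge {a : V} (w : G.Walk a a) (hw : w.IsCycle) {r r' : Sphere2}
    (hr : r ∉ E.walkImage w) (hr' : r' ∉ E.walkImage w) (hns : ¬ NS (E.walkImage w) r r')
    {u v : V} (h : G.Adj u v) (he : s(u, v) ∈ w.edges) :
    Set.range (E.arc h) ⊆ closure (connectedComponentIn (E.walkImage w)ᶜ r) := by
  obtain ⟨u', v', h', P, e1, hP, heP, hC⟩ := E.cycle_split w hw he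
  have := E.bd_aux h' P hP heP hC hr hr' hns
  rw [← E.edgeInt_congr h h' e1] at this
  exact (E.arc_subset_closure h).trans (closure_minimal this isClosed_closure)

lemma mem_arc_of_not_nil {a b : V} (p : G.Walk a b) (hp : ¬ p.Nil) {z : Sphere2}
    (hz : z ∈ E.walkImage p) :
    ∃ (u v : V) (h : G.Adj u v), s(u, v) ∈ p.edges ∧ z ∈ Set.range (E.arc h) := by
  induction p with
  | nil => simp at hp
  | @cons u v _ h p ih =>
    rcases hz with hz | hz
    · exact ⟨u, v, h, by simp, hz⟩
    · by_cases hn : p.Nil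
      · cases p with
        | nil => exact ⟨_, _, h, by simp, by rw [show z = _ from hz]; exact E.right_mem h⟩
        | cons h' p => simp at hn
      · obtain ⟨x, y, h', h1, h2⟩ := ih hn hz
        exact ⟨x, y, h', by simp [h1], h2⟩

lemma bd {a : V} (w : G.Walk a a) (hw : w.IsCycle) {r r' : Sphere2}
    (hr : r ∉ E.walkImage w) (hr' : r' ∉ E.walkImage w) (hns : ¬ NS (E.walkImage w) r r') :
    E.walkImage w ⊆ closure (connectedComponentIn (E.walkImage w)ᶜ r) := by
  intro z hz
  obtain ⟨u, v, h, he, hz⟩ := E.mem_arc_of_not_nil w hw.not_nil hz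
  exact E.bd_edge w hw hr hr' hns h he hz

section conn
variable [Fintype V] [DecidableEq V] (hcard : 3 ≤ Fintype.card V)
  (h2conn : ∀ v : V, (G.induce ({v}ᶜ : Set V)).Connected)

lemma third (hcard : 3 ≤ Fintype.card V) (x y : V) : ∃ c, c ≠ x ∧ c ≠ y := by
  by_contra! hall
  have h1 : (Finset.univ : Finset V) ⊆ {x, y} := fun c _ => by
    by_cases h : c = x
    · simp [h]
    · simp [hall c h]
  have h2 := Finset.card_le_card h1
  rw [Finset.card_univ] at h2
  have := Finset.card_le_two (a := x) (b := y)
  omega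

lemma avoid (h2conn : ∀ v : V, (G.induce ({v}ᶜ : Set V)).Connected) {x y t : V} (hy : y ≠ x)
    (ht : t ≠ x) : ∃ Q : G.Walk y t, x ∉ Q.support := by
  have hy' : y ∈ ({x}ᶜ : Set V) := hy
  have ht' : t ∈ ({x}ᶜ : Set V) := ht
  obtain ⟨Q⟩ := (h2conn x).preconnected ⟨y, hy'⟩ ⟨t, ht'⟩
  refine ⟨Q.map (Embedding.induce _).toHom, ?_⟩
  intro h
  obtain ⟨c, -, hc⟩ := List.mem_map.1
    (cast (congrArg (x ∈ ·) (Walk.support_map (Embedding.induce ({x}ᶜ : Set V)).toHom Q)) h)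
  exact c.2 hc

lemma exists_walk (hcard : 3 ≤ Fintype.card V)
    (h2conn : ∀ v : V, (G.induce ({v}ᶜ : Set V)).Connected) (x y : V) : Nonempty (G.Walk x y) := by
  obtain ⟨c, h1, h2⟩ := third hcard x y
  exact ⟨(avoid h2conn h1.symm h2.symm).choose⟩

lemma exists_adj (hcard : 3 ≤ Fintype.card V)
    (h2conn : ∀ v : V, (G.induce ({v}ᶜ : Set V)).Connected) (x : V) : ∃ y, G.Adj x y := by
  obtain ⟨c, h1, -⟩ := third hcard x x
  obtain ⟨Q⟩ := exists_walk hcard h2conn x c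
  cases Q with
  | nil => exact absurd rfl h1
  | cons h p => exact ⟨_, h⟩

lemma interior_image (hcard : 3 ≤ Fintype.card V)
    (h2conn : ∀ v : V, (G.induce ({v}ᶜ : Set V)).Connected) : interior E.image = ∅ := by
  have hsub : E.image ⊆ ⋃ i : {x : V × V // G.Adj x.1 x.2}, Set.range (E.arc i.2) := by
    intro z hz
    simp only [Set.mem_iUnion]
    rcases hz with ⟨x, rfl⟩ | hz
    · obtain ⟨y, hy⟩ := exists_adj hcard h2conn x
      exact ⟨⟨(x, y), hy⟩, E.left_mem hy⟩
    · simp only [Set.mem_iUnion] at hz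
      obtain ⟨u, v, h, hz⟩ := hz
      exact ⟨⟨(u, v), h⟩, hz⟩
  have hd : Dense (⋂ i : {x : V × V // G.Adj x.1 x.2}, (Set.range (E.arc i.2))ᶜ) := by
    apply dense_iInter_of_isOpen
    · intro i; exact (E.arc_closed i.2).isOpen_compl
    · intro i
      rw [← interior_eq_empty_iff_dense_compl]
      exact arc_interior_empty _ (E.arc i.2).continuous (E.arc_inj i.2)
  rw [← Set.compl_iUnion, ← interior_eq_empty_iff_dense_compl] at hd
  exact Set.subset_empty_iff.1 (hd ▸ interior_mono hsub)

/-- There are points outside the graph that are not in a given face. -/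
lemma exists_q (hcard : 3 ≤ Fintype.card V)
    (h2conn : ∀ v : V, (G.induce ({v}ᶜ : Set V)).Connected) {p : Sphere2} (hp : p ∉ E.image) :
    ∃ q, q ∉ E.image ∧ ¬ NS E.image p q := by
  have : Nonempty V := Fintype.card_pos_iff.1 (by omega)
  obtain ⟨x⟩ := this
  obtain ⟨z, hxz⟩ := exists_adj hcard h2conn x
  obtain ⟨u, hux, huz⟩ := third hcard x z
  obtain ⟨P₁, hP₁⟩ := avoid h2conn hxz.ne huz
  obtain ⟨P₂, hP₂⟩ := avoid h2conn hux hxz.ne.symm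
  have he : s(x, z) ∉ (P₁.append P₂).edges := by
    rw [Walk.edges_append, List.mem_append]
    rintro (h | h)
    · exact hP₁ (P₁.snd_mem_support_of_mem_edges h)
    · exact hP₂ (P₂.fst_mem_support_of_mem_edges h)
  set P := P₁.append P₂
  have hsep := jordan_sep (E.arc_closed hxz) (E.walkImage_closed P) (E.arc_conn hxz)
    (E.walkImage_conn P) (E.vmap_inj.ne hxz.ne) (E.left_mem hxz) (E.right_mem hxz)
    (E.vmap_mem_walkImage P P.start_mem_support) (E.vmap_mem_walkImage P P.end_mem_support)
    (by
      rintro y ⟨h1, h2⟩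
      rcases E.arc_cases hxz h1 with h | h | h
      · exact Or.inl h
      · exact Or.inr h
      · exact absurd (E.mem_edges_of_edgeInt P hxz h h2) he)
  set T := Set.range (E.arc hxz) ∪ E.walkImage P
  have hTc : IsClosed T := (E.arc_closed hxz).union (E.walkImage_closed P)
  have hTi : T ⊆ E.image := Set.union_subset (E.arc_subset_image hxz) (E.walkImage_subset_image P)
  have hpT : p ∉ T := fun h => hp (hTi h)
  obtain ⟨q₀, hq₀, hns⟩ : ∃ q₀, q₀ ∉ T ∧ ¬ NS T p q₀ := by
    by_contra! hall
    apply hsep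
    apply isPreconnected_of_forall p
    intro y hy
    obtain ⟨S, h1, h2, h3, h4⟩ := hall y hy
    exact ⟨S, h2, h3, h4, h1⟩
  have hO : IsOpen (connectedComponentIn Tᶜ q₀) := hTc.isOpen_compl.connectedComponentIn
  obtain ⟨q, hq, hqi⟩ : ∃ q ∈ connectedComponentIn Tᶜ q₀, q ∉ E.image := by
    by_contra! hall
    have h1 : connectedComponentIn Tᶜ q₀ ⊆ interior E.image := interior_maximal hall hO
    rw [E.interior_image hcard h2conn] at h1
    exact h1 (mem_connectedComponentIn hq₀)
  refine ⟨q, hqi, fun h => hns ?_⟩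
  exact (h.mono hTi).trans ((ns_iff hq₀).2 hq).symm

end conn
end SphereEmbedding


namespace SphereEmbedding

variable {V : Type*} {G : SimpleGraph V} (E : SphereEmbedding G)

lemma comp_edge {a : V} (w : G.Walk a a) {p : Sphere2} {y x : V} (h : G.Adj y x)
    (hy : E.vmap y ∈ connectedComponentIn (E.walkImage w)ᶜ p) :
    E.edgeInt h ⊆ connectedComponentIn (E.walkImage w)ᶜ p := by
  apply comp_absorb (E.edgeInt_conn h)
  · intro z hz hzw
    have h1 := w.fst_mem_support_of_mem_edges (E.mem_edges_of_edgeInt w h hz hzw)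
    exact connectedComponentIn_subset _ _ hy (E.vmap_mem_walkImage w h1)
  · have h1 := E.arc_subset_closure h (E.left_mem h)
    rw [Set.inter_comm]
    exact mem_closure_iff.1 h1 _ (E.walkImage_closed w).isOpen_compl.connectedComponentIn hy

lemma comp_end {a : V} (w : G.Walk a a) {p : Sphere2} {y x : V} (h : G.Adj y x)
    (hy : E.edgeInt h ⊆ connectedComponentIn (E.walkImage w)ᶜ p) {c : V}
    (hc : E.vmap c ∈ Set.range (E.arc h)) (hcw : c ∉ w.support) :
    E.vmap c ∈ connectedComponentIn (E.walkImage w)ᶜ p := by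
  by_contra hn
  have h1 := closure_mono hy (E.arc_subset_closure h hc)
  have hO := (E.walkImage_closed w).isOpen_compl.connectedComponentIn (x := p)
  have h2 : E.vmap c ∈ frontier (connectedComponentIn (E.walkImage w)ᶜ p) := by
    rw [hO.frontier_eq]; exact ⟨h1, hn⟩
  exact hcw (E.mem_support_of_vmap w (frontier_component (E.walkImage_closed w) p h2))

lemma ear_walk {a : V} (w : G.Walk a a) {p : Sphere2} {x y t : V} (Q : G.Walk y t)
    (hx : x ∉ Q.support) (ht : t ∈ w.support)
    (hy : E.vmap y ∈ connectedComponentIn (E.walkImage w)ᶜ p) :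
    ∃ x' ∈ w.support, x' ≠ x ∧ ∃ T : Set Sphere2, IsClosed T ∧ IsPreconnected T ∧
      E.vmap y ∈ T ∧ E.vmap x' ∈ T ∧ T ⊆ E.image ∧
      T ⊆ connectedComponentIn (E.walkImage w)ᶜ p ∪ {E.vmap x'} := by
  induction Q with
  | nil => exact absurd (E.vmap_mem_walkImage w ht) (connectedComponentIn_subset _ _ hy)
  | @cons y y₂ t h Q ih =>
    have he := E.comp_edge w h hy
    rw [Walk.support_cons, List.mem_cons, not_or] at hx
    by_cases hy₂ : y₂ ∈ w.support
    · refine ⟨y₂, hy₂, fun h' => hx.2 (h' ▸ Q.start_mem_support), Set.range (E.arc h),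
        E.arc_closed h, E.arc_conn h, E.left_mem h, E.right_mem h, E.arc_subset_image h, ?_⟩
      intro z hz
      rcases E.arc_cases h hz with rfl | rfl | hz
      · exact Or.inl hy
      · exact Or.inr rfl
      · exact Or.inl (he hz)
    · have hA := E.comp_end w h he (E.right_mem h) hy₂
      obtain ⟨x', h1, h2, T, h3, h4, h5, h6, h7, h8⟩ := ih hx.2 ht hA
      refine ⟨x', h1, h2, Set.range (E.arc h) ∪ T, (E.arc_closed h).union h3,
        (E.arc_conn h).union _ (E.right_mem h) h5 h4, Or.inl (E.left_mem h), Or.inr h6,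
        Set.union_subset (E.arc_subset_image h) h7, Set.union_subset ?_ h8⟩
      intro z hz
      rcases E.arc_cases h hz with rfl | rfl | hz
      · exact Or.inl hy
      · exact Or.inl hA
      · exact Or.inl (he hz)

lemma cycle_other {a : V} (w : G.Walk a a) (hw : w.IsCycle) (x : V) : ∃ t ∈ w.support, t ≠ x := by
  cases w with
  | nil => simp at hw
  | @cons a b _ h P =>
    by_cases hx : a = x
    · exact ⟨b, by simp, fun h' => h.ne (hx.trans h'.symm)⟩
    · exact ⟨a, by simp, hx⟩

lemma ear_vertex [Fintype V] [DecidableEq V] (hcard : 3 ≤ Fintype.card V)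
    (h2conn : ∀ v : V, (G.induce ({v}ᶜ : Set V)).Connected)
    {a : V} (w : G.Walk a a) (hw : w.IsCycle) {p : Sphere2} {y₀ : V}
    (hy₀ : E.vmap y₀ ∈ connectedComponentIn (E.walkImage w)ᶜ p) :
    ∃ x ∈ w.support, ∃ x' ∈ w.support, x ≠ x' ∧ ∃ T : Set Sphere2, IsClosed T ∧ IsPreconnected T ∧
      E.vmap x ∈ T ∧ E.vmap x' ∈ T ∧ T ⊆ E.image ∧
      T ⊆ connectedComponentIn (E.walkImage w)ᶜ p ∪ {E.vmap x, E.vmap x'} := by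
  obtain ⟨Q₀⟩ := exists_walk hcard h2conn y₀ a
  obtain ⟨d, -, hd1, hd2⟩ := Q₀.exists_boundary_dart
    {c | E.vmap c ∈ connectedComponentIn (E.walkImage w)ᶜ p} hy₀
    (fun h => connectedComponentIn_subset _ _ h (E.vmap_mem_walkImage w w.start_mem_support))
  obtain ⟨⟨y, x⟩, h⟩ := d
  change G.Adj y x at h
  change E.vmap y ∈ connectedComponentIn (E.walkImage w)ᶜ p at hd1
  change ¬ E.vmap x ∈ connectedComponentIn (E.walkImage w)ᶜ p at hd2
  have he := E.comp_edge w h hd1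
  have hx : x ∈ w.support := by
    by_contra hx
    exact hd2 (E.comp_end w h he (E.right_mem h) hx)
  obtain ⟨t, ht, htx⟩ := cycle_other w hw x
  obtain ⟨Q, hQ⟩ := avoid h2conn h.ne htx
  obtain ⟨x', h1, h2, T, h3, h4, h5, h6, h7, h8⟩ := E.ear_walk w Q hQ ht hd1
  refine ⟨x, hx, x', h1, h2.symm, Set.range (E.arc h) ∪ T, (E.arc_closed h).union h3,
    (E.arc_conn h).union _ (E.left_mem h) h5 h4, Or.inl (E.right_mem h), Or.inr h6,
    Set.union_subset (E.arc_subset_image h) h7, Set.union_subset ?_ ?_⟩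
  · intro z hz
    rcases E.arc_cases h hz with rfl | rfl | hz
    · exact Or.inl hd1
    · exact Or.inr (Or.inl rfl)
    · exact Or.inl (he hz)
  · intro z hz
    rcases h8 hz with hz | hz
    · exact Or.inl hz
    · exact Or.inr (Or.inr hz)

lemma ear [Fintype V] [DecidableEq V] (hcard : 3 ≤ Fintype.card V)
    (h2conn : ∀ v : V, (G.induce ({v}ᶜ : Set V)).Connected)
    {a : V} (w : G.Walk a a) (hw : w.IsCycle) {p : Sphere2}
    (hne : (connectedComponentIn (E.walkImage w)ᶜ p ∩ E.image).Nonempty) :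
    ∃ x ∈ w.support, ∃ x' ∈ w.support, x ≠ x' ∧ ∃ T : Set Sphere2, IsClosed T ∧ IsPreconnected T ∧
      E.vmap x ∈ T ∧ E.vmap x' ∈ T ∧ T ⊆ E.image ∧
      T ⊆ connectedComponentIn (E.walkImage w)ᶜ p ∪ {E.vmap x, E.vmap x'} := by
  obtain ⟨z, hz, hzi⟩ := hne
  rcases hzi with ⟨y, rfl⟩ | hzi
  · exact E.ear_vertex hcard h2conn w hw hz
  simp only [Set.mem_iUnion] at hzi
  obtain ⟨u, v, h, hzi⟩ := hzi
  rcases E.arc_cases h hzi with rfl | rfl | hzi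
  · exact E.ear_vertex hcard h2conn w hw hz
  · exact E.ear_vertex hcard h2conn w hw hz
  have he : E.edgeInt h ⊆ connectedComponentIn (E.walkImage w)ᶜ p := by
    apply comp_absorb (E.edgeInt_conn h) _ ⟨z, hzi, hz⟩
    intro y hy hyw
    exact connectedComponentIn_subset _ _ hz
      (E.arc_subset_walkImage w h (E.mem_edges_of_edgeInt w h hy hyw) hzi.1)
  by_cases hu : u ∈ w.support
  swap
  · exact E.ear_vertex hcard h2conn w hw (E.comp_end w h he (E.left_mem h) hu)
  by_cases hv : v ∈ w.support
  swap
  · exact E.ear_vertex hcard h2conn w hw (E.comp_end w h he (E.right_mem h) hv)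
  refine ⟨u, hu, v, hv, h.ne, Set.range (E.arc h), E.arc_closed h, E.arc_conn h, E.left_mem h,
    E.right_mem h, E.arc_subset_image h, ?_⟩
  intro z hz
  rcases E.arc_cases h hz with rfl | rfl | hz
  · exact Or.inr (Or.inl rfl)
  · exact Or.inr (Or.inr rfl)
  · exact Or.inl (he hz)

lemma cycle_two [DecidableEq V] {a : V} (w : G.Walk a a) (hw : w.IsCycle) {x x' : V}
    (hx : x ∈ w.support) (hx' : x' ∈ w.support) :
    ∃ (P₁ : G.Walk x x') (P₂ : G.Walk x' x), E.walkImage w = E.walkImage P₁ ∪ E.walkImage P₂ ∧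
      E.walkImage P₁ ∩ E.walkImage P₂ ⊆ {E.vmap x, E.vmap x'} ∧
      (∀ e ∈ P₁.edges, e ∈ w.edges) ∧ (∀ e ∈ P₂.edges, e ∈ w.edges) := by
  have hrot : E.walkImage (w.rotate x hx) = E.walkImage w := by
    conv_rhs => rw [← Walk.take_spec w hx]
    rw [Walk.rotate, walkImage_append, walkImage_append, Set.union_comm]
  have hc : (w.rotate x hx).IsCycle := hw.rotate hx
  have hed : ∀ e ∈ (w.rotate x hx).edges, e ∈ w.edges := fun e he =>
    (Walk.rotate_edges w x hx).mem_iff.1 he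
  set c := w.rotate x hx
  have hxc : x' ∈ c.support := E.mem_support_of_vmap c (hrot ▸ E.vmap_mem_walkImage w hx')
  have hspec := Walk.take_spec c hxc
  have hed' : ∀ e, e ∈ (c.takeUntil x' hxc).edges ∨ e ∈ (c.dropUntil x' hxc).edges →
      e ∈ c.edges := by
    intro e he
    rw [← hspec, Walk.edges_append, List.mem_append]; exact he
  refine ⟨c.takeUntil x' hxc, c.dropUntil x' hxc, ?_, ?_, fun e he => hed e (hed' e (Or.inl he)),
    fun e he => hed e (hed' e (Or.inr he))⟩
  · rw [← hrot, ← walkImage_append, hspec]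
  · have n1 := hc.support_nodup
    have n2 := hc.edges_nodup
    rw [← hspec, Walk.tail_support_append] at n1
    rw [← hspec, Walk.edges_append] at n2
    rintro z ⟨h1, h2⟩
    rcases E.mem_walkImage _ h1 with ⟨d, hd, rfl⟩ | ⟨u, v, h, he, hz⟩
    · have hd2 := E.mem_support_of_vmap _ h2
      rw [Walk.mem_support_iff] at hd hd2
      rcases hd with rfl | hd
      · exact Or.inl rfl
      rcases hd2 with rfl | hd2
      · exact Or.inr rfl
      exact absurd hd2 (List.disjoint_of_nodup_append n1 hd)
    · have he2 := E.mem_edges_of_edgeInt _ h hz h2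
      exact absurd he2 (List.disjoint_of_nodup_append n2 he)

lemma ns_of_touch {D F B : Set Sphere2} (hD : IsClosed D) (hF : IsPreconnected F) (hFD : F ⊆ Dᶜ)
    (hB : IsPreconnected B) (hBD : B ⊆ Dᶜ) {p q x : Sphere2} (hp : p ∈ F) (hq : q ∈ B)
    (hx : x ∉ D) (hxF : x ∈ closure F) (hxB : x ∈ closure B) : NS D p q := by
  have hO : IsOpen (connectedComponentIn Dᶜ x) := hD.isOpen_compl.connectedComponentIn
  have hm : x ∈ connectedComponentIn Dᶜ x := mem_connectedComponentIn hx
  obtain ⟨f, hf1, hf2⟩ := mem_closure_iff.1 hxF _ hO hm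
  obtain ⟨g, hg1, hg2⟩ := mem_closure_iff.1 hxB _ hO hm
  have n1 : NS D p f := ⟨F, hF, hFD, hp, hf2⟩
  have n2 : NS D g q := ⟨B, hB, hBD, hg2, hq⟩
  exact n1.trans (((ns_iff hx).2 hf1).symm.trans (((ns_iff hx).2 hg1).trans n2))

lemma theta_half {P Q T F B A : Set Sphere2} {a x x' : V} (w : G.Walk a a) (P₁ : G.Walk x x')
    (hxx : x ≠ x') (hPe : ∀ e ∈ P₁.edges, e ∈ w.edges)
    (hP : E.walkImage P₁ = P) (hQ : IsClosed Q) (hT : IsClosed T)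
    (hPQ : P ∩ Q ⊆ {E.vmap x, E.vmap x'})
    (hL : ∀ e ∈ w.edges, ∃ (u v : V) (h : G.Adj u v), e = s(u, v) ∧
      (E.edgeInt h ∩ closure F).Nonempty)
    (hF : IsPreconnected F) (hFi : F ⊆ E.imageᶜ) (hB : IsPreconnected B)
    (hQi : Q ⊆ E.image) (hTi : T ⊆ E.image) (hBQ : B ⊆ Qᶜ) (hBT : B ⊆ Tᶜ)
    (hTA : T ⊆ A ∪ {E.vmap x, E.vmap x'}) (hAw : A ⊆ (E.walkImage w)ᶜ)
    (hwB : E.walkImage w ⊆ closure B)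
    {p q : Sphere2} (hp : p ∈ F) (hq : q ∈ B) : NS (Q ∪ T) p q := by
  obtain ⟨e, he⟩ : ∃ e, e ∈ P₁.edges := by
    cases P₁ with
    | nil => exact absurd rfl hxx
    | cons h P => exact ⟨_, by rw [Walk.edges_cons]; exact List.mem_cons_self⟩
  obtain ⟨u, v, h, rfl, z, hz, hzF⟩ := hL e (hPe e he)
  have hzP : z ∈ P := hP ▸ E.arc_subset_walkImage P₁ h he hz.1
  have hzw : z ∈ E.walkImage w := E.arc_subset_walkImage w h (hPe _ he) hz.1
  have hzv : z ∉ ({E.vmap x, E.vmap x'} : Set Sphere2) := by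
    rintro (h1 | h1)
    · exact E.edgeInt_ne h hz _ h1
    · exact E.edgeInt_ne h hz _ h1
  refine ns_of_touch (hQ.union hT) hF ?_ hB ?_ hp hq ?_ hzF (hwB hzw)
  · exact hFi.trans (Set.compl_subset_compl.2 (Set.union_subset hQi hTi))
  · rw [Set.compl_union]; exact Set.subset_inter hBQ hBT
  · rintro (h1 | h1)
    · exact hzv (hPQ ⟨hzP, h1⟩)
    · rcases hTA h1 with h2 | h2
      · exact hAw h2 hzw
      · exact hzv h2

end SphereEmbedding

/-- In any embedding of a 2-connected planar graph in the sphere, the boundary of every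
face is a cycle of the graph. -/
theorem face_boundary_is_cycle {V : Type*} [Fintype V] [DecidableEq V] (G : SimpleGraph V)
    (hcard : 3 ≤ Fintype.card V)
    (h2conn : ∀ v : V, (G.induce ({v}ᶜ : Set V)).Connected)
    (E : SphereEmbedding G) (F : Set Sphere2) (hF : E.IsFace F) :
    ∃ (a : V) (w : G.Walk a a), w.IsCycle ∧ frontier F = E.walkImage w := by
  classical
  obtain ⟨p, hp, rfl⟩ := hF
  have hp' : p ∉ E.image := hp
  obtain ⟨q, hq, hns⟩ := E.exists_q hcard h2conn hp'
  set F := connectedComponentIn E.imageᶜ p with hFdef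
  have hpF : p ∈ F := mem_connectedComponentIn hp
  have hqF : q ∉ F := fun h => hns ((ns_iff hp').2 h)
  have hFi : F ⊆ E.imageᶜ := connectedComponentIn_subset _ _
  have hFc : IsPreconnected F := isPreconnected_connectedComponentIn
  let L : Finset (Sym2 V) := {e | ∃ (u v : V) (h : G.Adj u v), e = s(u, v) ∧
    (E.edgeInt h ∩ closure F).Nonempty}
  have hLmem : ∀ e, e ∈ L ↔ ∃ (u v : V) (h : G.Adj u v), e = s(u, v) ∧
    (E.edgeInt h ∩ closure F).Nonempty := fun e => by simp [L]
  have hpart : E.part (fun _ => True) (L : Set (Sym2 V)) ⊆ E.image := by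
    intro z hz
    rcases E.mem_part.1 hz with ⟨c, -, rfl⟩ | ⟨u, v, h, -, hz⟩
    · exact Or.inl ⟨c, rfl⟩
    · exact E.arc_subset_image h hz
  have hfr : frontier F ⊆ E.part (fun _ => True) (L : Set (Sym2 V)) := by
    intro z hz
    rw [E.mem_part]
    rcases frontier_component E.image_closed p hz with ⟨c, rfl⟩ | hzi
    · exact Or.inl ⟨c, trivial, rfl⟩
    simp only [Set.mem_iUnion] at hzi
    obtain ⟨u, v, h, hzi⟩ := hzi
    rcases E.arc_cases h hzi with h1 | h1 | h1
    · exact Or.inl ⟨u, trivial, h1⟩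
    · exact Or.inl ⟨v, trivial, h1⟩
    · exact Or.inr ⟨u, v, h, ⟨(hLmem _).2 ⟨u, v, h, rfl, z, h1, hz.1⟩, trivial⟩, hzi⟩
  obtain ⟨a, w, hw, hwL, hwns⟩ := E.sep_cycle L (fun h => hp (hpart h)) (fun h => hq (hpart h))
    (not_ns_of_frontier hfr hpF hqF)
  have hCi := E.walkImage_subset_image w
  have hpC : p ∉ E.walkImage w := fun h => hp (hCi h)
  have hqC : q ∉ E.walkImage w := fun h => hq (hCi h)
  have hCc := E.walkImage_closed w
  have hbp := E.bd w hw hpC hqC hwns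
  have hbq := E.bd w hw hqC hpC (fun h => hwns h.symm)
  set A := connectedComponentIn (E.walkImage w)ᶜ p with hAdef
  set B := connectedComponentIn (E.walkImage w)ᶜ q with hBdef
  have hAC : A ⊆ (E.walkImage w)ᶜ := connectedComponentIn_subset _ _
  have hBC : B ⊆ (E.walkImage w)ᶜ := connectedComponentIn_subset _ _
  have hAB : ∀ z ∈ A, z ∉ B := by
    intro z hzA hzB
    exact hwns (((ns_iff hpC).2 hzA).trans ((ns_iff hqC).2 hzB).symm)
  have hB : IsPreconnected B := isPreconnected_connectedComponentIn
  have hqB : q ∈ B := mem_connectedComponentIn hqC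
  have hdis : A ∩ E.image = ∅ := by
    by_contra hne
    obtain ⟨x, hx, x', hx', hxx, T, hT1, hT2, hT3, hT4, hT5, hT6⟩ :=
      E.ear hcard h2conn w hw (Set.nonempty_iff_ne_empty.2 hne)
    obtain ⟨P₁, P₂, hP, hPP, he1, he2⟩ := E.cycle_two w hw hx hx'
    have hBT : B ⊆ Tᶜ := by
      intro z hzB hzT
      rcases hT6 hzT with h1 | h1 | h1
      · exact hAB z h1 hzB
      · exact hBC hzB (by rw [h1]; exact E.vmap_mem_walkImage w hx)
      · exact hBC hzB (by rw [show z = _ from h1]; exact E.vmap_mem_walkImage w hx')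
    have hB1 : B ⊆ (E.walkImage P₁)ᶜ := hBC.trans
      (Set.compl_subset_compl.2 (by rw [hP]; exact Set.subset_union_left))
    have hB2 : B ⊆ (E.walkImage P₂)ᶜ := hBC.trans
      (Set.compl_subset_compl.2 (by rw [hP]; exact Set.subset_union_right))
    have hL : ∀ e ∈ w.edges, ∃ (u v : V) (h : G.Adj u v), e = s(u, v) ∧
      (E.edgeInt h ∩ closure F).Nonempty := fun e he => (hLmem e).1 (hwL e he)
    have n1 : NS (E.walkImage P₂ ∪ T) p q :=
      E.theta_half w P₁ hxx he1 rfl (E.walkImage_closed P₂) hT1 hPP hL hFc hFi hB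
        (E.walkImage_subset_image P₂) hT5 hB2 hBT hT6 hAC hbq hpF hqB
    have n2 : NS (E.walkImage P₁ ∪ T) p q :=
      E.theta_half w P₂ hxx.symm he2 rfl (E.walkImage_closed P₁) hT1
        (by rw [Set.inter_comm, Set.pair_comm]; exact hPP) hL hFc hFi hB
        (E.walkImage_subset_image P₁) hT5 hB1 hBT (by rw [Set.pair_comm]; exact hT6) hAC hbq hpF hqB
    apply hwns
    refine (janiszewski ((E.walkImage_closed P₂).union hT1) ((E.walkImage_closed P₁).union hT1)
      ?_ n1 n2).mono ?_
    · have : (E.walkImage P₂ ∪ T) ∩ (E.walkImage P₁ ∪ T) = T := by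
        rw [← Set.inter_union_distrib_right]
        apply Set.union_eq_self_of_subset_left
        rintro z ⟨h2, h1⟩
        rcases hPP ⟨h1, h2⟩ with rfl | h
        · exact hT3
        · rw [show z = _ from h]; exact hT4
      rw [this]; exact hT2
    · rw [hP]
      exact Set.union_subset (Set.subset_union_left.trans Set.subset_union_right)
        (Set.subset_union_left.trans Set.subset_union_left)
  have hFA : F = A := by
    apply Set.Subset.antisymm
    · exact hFc.subset_connectedComponentIn hpF (hFi.trans (Set.compl_subset_compl.2 hCi))
    · refine IsPreconnected.subset_connectedComponentIn isPreconnected_connectedComponentIn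
        (mem_connectedComponentIn hpC) ?_
      intro z hz hzi
      exact (Set.eq_empty_iff_forall_notMem.1 hdis z) ⟨hz, hzi⟩
  refine ⟨a, w, hw, ?_⟩
  rw [hFA]
  apply Set.Subset.antisymm (frontier_component hCc p)
  intro z hz
  rw [(hCc.isOpen_compl.connectedComponentIn (x := p)).frontier_eq]
  exact ⟨hbp hz, fun h => hAC h hz⟩
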